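/- arXiv:2205.00879 — 3 statements merged into one kernel-verified Lean document; each statement's English description precedes it below -/
import Mathlib

section
/- Let F be a finite field with q elements and, for n ≥ 1, let k(n,q) be the number of conjugacy classes of the general linear group GL_n(F) of invertible n×n matrices over F. Then in ℤ[[X]], 1 + ∑_{n=1}^∞ k(n,q) X^n = ∏_{l=1}^∞ (1 − X^l)·(1 − qX^l)^{−1} (each 1 − qX^l has constant term 1 and is therefore invertible). -/
open PowerSeries Filter

/-- The product (coefficientwise) topology on formal power series; with discrete coefficients
this is exactly the `X`-adic topology for convergence purposes: a sequence converges iff for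
every `n` the sequence of `n`-th coefficients is eventually constant. -/
noncomputable instance powerSeriesTopology (R : Type*) [TopologicalSpace R] :
    TopologicalSpace (PowerSeries R) :=
  inferInstanceAs (TopologicalSpace ((Unit →₀ ℕ) → R))

/-- The inverse of a power series with constant term `1` (given by `invOfUnit` at the unit `1`);
for such a series `φ` it satisfies `φ * inv1 φ = 1`. -/
noncomputable def inv1 (φ : PowerSeries ℤ) : PowerSeries ℤ := φ.invOfUnit 1

section CyclicModules

variable {R : Type*} [CommRing R]

/-- Multiplication by `c` as a map `R ⧸ (x) → R ⧸ (y)`, when `y ∣ c * x`. -/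
def quotMul (c x y : R) (h : y ∣ c * x) :
    (R ⧸ Ideal.span {x}) →ₗ[R] (R ⧸ Ideal.span {y}) :=
  Submodule.mapQ (Ideal.span {x}) (Ideal.span {y}) (LinearMap.lsmul R R c) (by
    intro z hz
    rw [Ideal.mem_span_singleton] at hz
    obtain ⟨w, rfl⟩ := hz
    simp only [Submodule.mem_comap, LinearMap.lsmul_apply, smul_eq_mul]
    rw [Ideal.mem_span_singleton, ← mul_assoc]
    exact h.mul_right w)

lemma quotMul_mk (c x y : R) (h : y ∣ c * x) (z : R) :
    quotMul c x y h (Ideal.Quotient.mk _ z) = Ideal.Quotient.mk _ (c * z) := rfl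

lemma nonempty_quot_prod_equiv (g a b u v : R) (h : u * a + v * b = 1) :
    Nonempty (((R ⧸ Ideal.span {g * a}) × (R ⧸ Ideal.span {g * b})) ≃ₗ[R]
      ((R ⧸ Ideal.span {g * a * b}) × (R ⧸ Ideal.span {g}))) := by
  refine ⟨LinearEquiv.ofLinearMap
    (((quotMul b (g * a) (g * a * b) ⟨1, by ring⟩).coprod
      (quotMul a (g * b) (g * a * b) ⟨1, by ring⟩)).prod
      ((quotMul (-u) (g * a) g ⟨-u * a, by ring⟩).coprod
        (quotMul v (g * b) g ⟨v * b, by ring⟩)))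
    (((quotMul v (g * a * b) (g * a) ⟨v * b, by ring⟩).coprod
      (quotMul (-a) g (g * a) ⟨-1, by ring⟩)).prod
      ((quotMul u (g * a * b) (g * b) ⟨u * a, by ring⟩).coprod
        (quotMul b g (g * b) ⟨1, by ring⟩))) ?_ ?_⟩
  · refine LinearMap.ext fun p => ?_
    obtain ⟨x, y⟩ := p
    obtain ⟨x, rfl⟩ := Ideal.Quotient.mk_surjective x
    obtain ⟨y, rfl⟩ := Ideal.Quotient.mk_surjective y
    refine Prod.ext ?_ ?_
    · change Ideal.Quotient.mk _ (b * (v * x + -a * y) + a * (u * x + b * y)) =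
        Ideal.Quotient.mk _ x
      congr 1
      linear_combination x * h
    · change Ideal.Quotient.mk _ (-u * (v * x + -a * y) + v * (u * x + b * y)) =
        Ideal.Quotient.mk _ y
      congr 1
      linear_combination y * h
  · refine LinearMap.ext fun p => ?_
    obtain ⟨x, y⟩ := p
    obtain ⟨x, rfl⟩ := Ideal.Quotient.mk_surjective x
    obtain ⟨y, rfl⟩ := Ideal.Quotient.mk_surjective y
    refine Prod.ext ?_ ?_
    · change Ideal.Quotient.mk _ (v * (b * x + a * y) + -a * (-u * x + v * y)) =
        Ideal.Quotient.mk _ x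
      congr 1
      linear_combination x * h
    · change Ideal.Quotient.mk _ (u * (b * x + a * y) + b * (-u * x + v * y)) =
        Ideal.Quotient.mk _ y
      congr 1
      linear_combination y * h

/-- In a Bézout domain, `R ⧸ (a) × R ⧸ (b) ≃ R ⧸ (lcm a b) × R ⧸ (gcd a b)`. -/
lemma exists_quot_prod_equiv [IsDomain R] [IsBezout R] (a b : R) :
    ∃ l g : R, g ∣ a ∧ g ∣ b ∧ a ∣ l ∧ b ∣ l ∧ (∀ m, a ∣ m → b ∣ m → l ∣ m) ∧
      Nonempty (((R ⧸ Ideal.span {a}) × (R ⧸ Ideal.span {b})) ≃ₗ[R]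
        ((R ⧸ Ideal.span {l}) × (R ⧸ Ideal.span {g}))) := by
  by_cases h0 : a = 0 ∧ b = 0
  · obtain ⟨rfl, rfl⟩ := h0
    exact ⟨0, 0, dvd_rfl, dvd_rfl, dvd_rfl, dvd_rfl, fun m h _ => h, ⟨LinearEquiv.refl _ _⟩⟩
  obtain ⟨a', ha⟩ := IsBezout.gcd_dvd_left a b
  obtain ⟨b', hb⟩ := IsBezout.gcd_dvd_right a b
  obtain ⟨u, v, huv⟩ := IsBezout.gcd_eq_sum a b
  set g := IsBezout.gcd a b with hg
  have hg0 : g ≠ 0 := by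
    intro h
    exact h0 ⟨by rw [ha, h, zero_mul], by rw [hb, h, zero_mul]⟩
  have h1 : u * a' + v * b' = 1 := by
    apply mul_left_cancel₀ hg0
    rw [mul_one]
    linear_combination huv - u * ha - v * hb
  refine ⟨a * b', g, ⟨a', ha⟩, ⟨b', hb⟩, ⟨b', rfl⟩,
    ⟨a', by linear_combination b' * ha - a' * hb⟩, ?_, ?_⟩
  · rintro m ⟨s, hs⟩ ⟨t, ht⟩
    refine ⟨v * s + u * t, ?_⟩
    linear_combination (-m) * h1 + v * b' * hs + u * a' * ht + u * t * (a' * hb - b' * ha)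
  · have := nonempty_quot_prod_equiv g a' b' u v h1
    rwa [← hb, show g * a' = a from ha.symm] at this

/-- Inserting a cyclic module into a product of cyclic modules along a divisibility chain. -/
lemma exists_chain_cons [IsDomain R] [IsBezout R] (k : ℕ) :
    ∀ (d : Fin k → R), (∀ i j, i ≤ j → d j ∣ d i) → ∀ c : R,
    ∃ d' : Fin (k + 1) → R, (∀ i j, i ≤ j → d' j ∣ d' i) ∧
      (∀ m, c ∣ m → (∀ i, d i ∣ m) → ∀ i, d' i ∣ m) ∧
      Nonempty (((R ⧸ Ideal.span {c}) × (∀ i, R ⧸ Ideal.span {d i})) ≃ₗ[R]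
        (∀ i, R ⧸ Ideal.span {d' i})) := by
  induction k with
  | zero =>
    intro d _ c
    refine ⟨fun _ => c, fun _ _ _ => dvd_rfl, fun m hm _ _ => hm, ⟨?_⟩⟩
    exact (LinearEquiv.prodUnique).trans
      (LinearEquiv.piUnique R (fun _ : Fin 1 => R ⧸ Ideal.span {c})).symm
  | succ k ih =>
    intro d hd c
    obtain ⟨l, g, hgc, hg0, hcl, h0l, hl, ⟨e⟩⟩ := exists_quot_prod_equiv c (d 0)
    obtain ⟨d', hd', hm', ⟨e'⟩⟩ := ih (fun i => d i.succ)
      (fun i j h => hd _ _ (Fin.succ_le_succ_iff.2 h)) g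
    refine ⟨Fin.cons l d', ?_, ?_, ⟨?_⟩⟩
    · intro i j hij
      induction i using Fin.cases with
      | zero =>
        induction j using Fin.cases with
        | zero => exact dvd_rfl
        | succ j =>
          exact hm' l (hgc.trans hcl) (fun i => (hd 0 i.succ (Fin.zero_le _)).trans h0l) j
      | succ i =>
        induction j using Fin.cases with
        | zero => simp at hij
        | succ j => exact hd' i j (Fin.succ_le_succ_iff.1 hij)
    · intro m hc hdm i
      induction i using Fin.cases with
      | zero => exact hl m hc (hdm 0)
      | succ i => exact hm' m (hgc.trans hc) (fun i => hdm i.succ) i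
    · exact (LinearEquiv.prodCongr (LinearEquiv.refl R _)
          (Fin.consLinearEquiv R (fun i => R ⧸ Ideal.span {d i})).symm).trans <|
        (LinearEquiv.prodAssoc R _ _ _).symm.trans <|
        (LinearEquiv.prodCongr e (LinearEquiv.refl R _)).trans <|
        (LinearEquiv.prodAssoc R _ _ _).trans <|
        (LinearEquiv.prodCongr (LinearEquiv.refl R _) e').trans <|
        Fin.consLinearEquiv R
          (fun i => R ⧸ Ideal.span {(Fin.cons l d' : Fin (k + 2) → R) i})

/-- A finite product of cyclic modules is a product along an arbitrarily long divisibility chain. -/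
lemma exists_chain_equiv [IsDomain R] [IsBezout R] (N k : ℕ) (c : Fin k → R) :
    ∃ d : Fin (N + k) → R, (∀ i j, i ≤ j → d j ∣ d i) ∧
      Nonempty ((∀ i, R ⧸ Ideal.span {c i}) ≃ₗ[R] (∀ i, R ⧸ Ideal.span {d i})) := by
  induction k with
  | zero =>
    refine ⟨fun _ => 1, fun _ _ _ => dvd_rfl, ⟨?_⟩⟩
    have : Subsingleton (R ⧸ Ideal.span {(1 : R)}) := by
      rw [Ideal.Quotient.subsingleton_iff, Ideal.span_singleton_one]
    exact 0
  | succ k ih =>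
    obtain ⟨d, hd, ⟨e⟩⟩ := ih (fun i => c i.succ)
    obtain ⟨d', hd', -, ⟨e'⟩⟩ := exists_chain_cons _ d hd (c 0)
    exact ⟨d', hd', ⟨(Fin.consLinearEquiv R (fun i => R ⧸ Ideal.span {c i})).symm.trans <|
      (LinearEquiv.prodCongr (LinearEquiv.refl R _) e).trans e'⟩⟩

/-- Dropping trivial factors from the end of a product of cyclic modules. -/
lemma nonempty_pi_quot_castLE_equiv {N K : ℕ} (h : N ≤ K) (d : Fin K → R)
    (hd : ∀ i : Fin K, N ≤ i → IsUnit (d i)) :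
    Nonempty ((∀ i, R ⧸ Ideal.span {d i}) ≃ₗ[R]
      (∀ i : Fin N, R ⧸ Ideal.span {d (Fin.castLE h i)})) := by
  refine ⟨LinearEquiv.ofBijective
    (LinearMap.pi fun i => LinearMap.proj (Fin.castLE h i)) ⟨?_, ?_⟩⟩
  · intro x y hxy
    ext i
    by_cases hi : (i : ℕ) < N
    · exact congrFun hxy ⟨i, hi⟩
    · have : Subsingleton (R ⧸ Ideal.span {d i}) := by
        rw [Ideal.Quotient.subsingleton_iff]
        exact Ideal.span_singleton_eq_top.2 (hd i (not_lt.1 hi))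
      exact Subsingleton.elim _ _
  · intro y
    refine ⟨fun i => if hi : (i : ℕ) < N then y ⟨i, hi⟩ else 0, ?_⟩
    ext i
    simp

end CyclicModules
section CyclicPolynomialModules

/-- The kernel of multiplication by `a` on `R ⧸ (d)` has as many elements as `R ⧸ (gcd a d)`. -/
lemma natCard_torsionBy_quot {R : Type*} [EuclideanDomain R] [DecidableEq R] (a d : R)
    [Finite (R ⧸ Ideal.span {d})] :
    Nat.card (Submodule.torsionBy R (R ⧸ Ideal.span {d}) a) =
      Nat.card (R ⧸ Ideal.span {EuclideanDomain.gcd a d}) := by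
  set g := EuclideanDomain.gcd a d with hg
  set T : (R ⧸ Ideal.span {d}) →ₗ[R] (R ⧸ Ideal.span {d}) := LinearMap.lsmul R _ a with hT
  set π := quotMul 1 d g (by rw [one_mul]; exact EuclideanDomain.gcd_dvd_right a d) with hπ
  have hπs : Function.Surjective π := by
    intro y
    obtain ⟨y, rfl⟩ := Ideal.Quotient.mk_surjective y
    exact ⟨Ideal.Quotient.mk _ y, by rw [hπ, quotMul_mk, one_mul]⟩
  have hker : LinearMap.ker π = LinearMap.range T := by
    ext z
    obtain ⟨z, rfl⟩ := Ideal.Quotient.mk_surjective z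
    rw [LinearMap.mem_ker, hπ, quotMul_mk, one_mul, Ideal.Quotient.eq_zero_iff_mem,
      Ideal.mem_span_singleton]
    constructor
    · rintro ⟨w, rfl⟩
      refine ⟨Ideal.Quotient.mk _ (EuclideanDomain.gcdA a d * w), ?_⟩
      change Ideal.Quotient.mk _ (a * (EuclideanDomain.gcdA a d * w)) = _
      rw [Ideal.Quotient.mk_eq_mk_iff_sub_mem, Ideal.mem_span_singleton]
      refine ⟨-(EuclideanDomain.gcdB a d * w), ?_⟩
      rw [hg, EuclideanDomain.gcd_eq_gcd_ab a d]
      ring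
    · rintro ⟨y, hy⟩
      obtain ⟨y, rfl⟩ := Ideal.Quotient.mk_surjective y
      change Ideal.Quotient.mk _ (a * y) = _ at hy
      rw [Ideal.Quotient.mk_eq_mk_iff_sub_mem, Ideal.mem_span_singleton] at hy
      have h1 : g ∣ a * y - z := (EuclideanDomain.gcd_dvd_right a d).trans hy
      have h2 : g ∣ a * y := (EuclideanDomain.gcd_dvd_left a d).mul_right y
      simpa using dvd_sub h2 h1
  have h1 := Submodule.card_eq_card_quotient_mul_card (LinearMap.ker T)
  have h2 := Submodule.card_eq_card_quotient_mul_card (LinearMap.ker π)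
  rw [Nat.card_congr T.quotKerEquivRange.toEquiv] at h1
  rw [Nat.card_congr (π.quotKerEquivOfSurjective hπs).toEquiv, hker, h1, mul_comm] at h2
  exact Nat.eq_of_mul_eq_mul_left Nat.card_pos h2

variable {F : Type*} [Field F]

lemma finite_quot [Finite F] {d : Polynomial F} (hd : d ≠ 0) :
    Finite (Polynomial F ⧸ Ideal.span {d}) :=
  have : Module.Finite F (Polynomial F ⧸ Ideal.span {d}) :=
    (AdjoinRoot.powerBasis hd).finite
  Module.finite_of_finite F

lemma natCard_quot [Fintype F] {d : Polynomial F} (hd : d ≠ 0) :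
    Nat.card (Polynomial F ⧸ Ideal.span {d}) = Fintype.card F ^ d.natDegree := by
  have : Module.Finite F (Polynomial F ⧸ Ideal.span {d}) :=
    (AdjoinRoot.powerBasis hd).finite
  rw [Module.natCard_eq_pow_finrank (K := F), finrank_quotient_span_eq_natDegree,
    Nat.card_eq_fintype_card]

lemma natCard_pi_quot [Fintype F] {N : ℕ} (d : Fin N → Polynomial F) (hd : ∀ i, d i ≠ 0) :
    Nat.card (∀ i, Polynomial F ⧸ Ideal.span {d i}) =
      Fintype.card F ^ ∑ i, (d i).natDegree := by
  rw [Nat.card_pi, ← Finset.prod_pow_eq_pow_sum]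
  exact Finset.prod_congr rfl fun i _ => natCard_quot (hd i)

lemma natCard_torsionBy_pi_quot [Fintype F] [DecidableEq (Polynomial F)] {N : ℕ}
    (d : Fin N → Polynomial F) (hd : ∀ i, d i ≠ 0) (a : Polynomial F) :
    Nat.card (Submodule.torsionBy (Polynomial F) (∀ i, Polynomial F ⧸ Ideal.span {d i}) a) =
      Fintype.card F ^ ∑ i, (EuclideanDomain.gcd a (d i)).natDegree := by
  have e : Submodule.torsionBy (Polynomial F) (∀ i, Polynomial F ⧸ Ideal.span {d i}) a ≃
      (∀ i, Submodule.torsionBy (Polynomial F) (Polynomial F ⧸ Ideal.span {d i}) a) :=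
    (Equiv.subtypeEquivRight fun x => by
      simp only [Submodule.mem_torsionBy_iff]; exact funext_iff).trans
      Equiv.subtypePiEquivPi
  rw [Nat.card_congr e, Nat.card_pi, ← Finset.prod_pow_eq_pow_sum]
  refine Finset.prod_congr rfl fun i _ => ?_
  have := finite_quot (hd i)
  rw [natCard_torsionBy_quot, natCard_quot]
  exact fun h => hd i (EuclideanDomain.gcd_eq_zero_iff.1 h).2

lemma chain_dvd_of_sum_natDegree_gcd_eq [DecidableEq (Polynomial F)] {N : ℕ}
    (d d' : Fin N → Polynomial F)
    (hd : ∀ i, d i ≠ 0) (hc : ∀ i j, i ≤ j → d j ∣ d i)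
    (k : Fin N) (hk : ∀ j, k < j → d j = d' j)
    (h : ∑ i, (EuclideanDomain.gcd (d k) (d i)).natDegree =
      ∑ i, (EuclideanDomain.gcd (d k) (d' i)).natDegree) : d k ∣ d' k := by
  have hle : ∀ i ∈ Finset.univ, (EuclideanDomain.gcd (d k) (d' i)).natDegree ≤
      (EuclideanDomain.gcd (d k) (d i)).natDegree := by
    intro i _
    rcases lt_or_ge k i with hi | hi
    · rw [hk i hi]
    · refine Polynomial.natDegree_le_of_dvd
        ((EuclideanDomain.gcd_dvd_left _ _).trans
          (EuclideanDomain.dvd_gcd dvd_rfl (hc _ _ hi))) ?_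
      exact fun h => hd k (EuclideanDomain.gcd_eq_zero_iff.1 h).1
  have heq := (Finset.sum_eq_sum_iff_of_le hle).1 h.symm k (Finset.mem_univ _)
  rw [EuclideanDomain.gcd_self] at heq
  have h1 := EuclideanDomain.gcd_dvd_left (d k) (d' k)
  exact (Polynomial.associated_of_dvd_of_natDegree_le h1 (hd k) heq.ge).symm.dvd.trans
    (EuclideanDomain.gcd_dvd_right _ _)

/-- Monic invariant factors are determined by the module. -/
lemma chain_eq_of_linearEquiv [Fintype F] {N : ℕ} (d d' : Fin N → Polynomial F)
    (hd : ∀ i, (d i).Monic) (hc : ∀ i j, i ≤ j → d j ∣ d i)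
    (hd' : ∀ i, (d' i).Monic) (hc' : ∀ i j, i ≤ j → d' j ∣ d' i)
    (e : (∀ i, Polynomial F ⧸ Ideal.span {d i}) ≃ₗ[Polynomial F]
      (∀ i, Polynomial F ⧸ Ideal.span {d' i})) : d = d' := by
  classical
  have h0 := fun i => (hd i).ne_zero
  have h0' := fun i => (hd' i).ne_zero
  have hsum : ∀ a, ∑ i, (EuclideanDomain.gcd a (d i)).natDegree =
      ∑ i, (EuclideanDomain.gcd a (d' i)).natDegree := by
    intro a
    apply Nat.pow_right_injective (Fintype.one_lt_card (α := F))
    simp only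
    rw [← natCard_torsionBy_pi_quot d h0, ← natCard_torsionBy_pi_quot d' h0']
    refine Nat.card_congr (e.toEquiv.subtypeEquiv fun x => ?_)
    rw [Submodule.mem_torsionBy_iff, Submodule.mem_torsionBy_iff]
    change a • x = 0 ↔ a • e x = 0
    rw [← map_smul, LinearEquiv.map_eq_zero_iff]
  have key : ∀ m : ℕ, ∀ k : Fin N, N ≤ k + m → d k = d' k := by
    intro m
    induction m with
    | zero => intro k hk; exact absurd k.2 (by omega)
    | succ m ih =>
      intro k hk
      have hgt : ∀ j, k < j → d j = d' j := fun j hj => ih j (by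
        have : (k : ℕ) < j := hj
        omega)
      refine Polynomial.eq_of_monic_of_associated (hd k) (hd' k) (associated_of_dvd_dvd ?_ ?_)
      · exact chain_dvd_of_sum_natDegree_gcd_eq d d' h0 hc k hgt (hsum _)
      · exact chain_dvd_of_sum_natDegree_gcd_eq d' d h0' hc' k
          (fun j hj => (hgt j hj).symm) (hsum _).symm
  exact funext fun k => key N k (by omega)

end CyclicPolynomialModules

section MatrixModules

open scoped Matrix

variable {F : Type*} [Field F] {n : ℕ}

/-- The `F[X]`-module structure on `Fⁿ` defined by an invertible matrix. -/
abbrev matrixModule (A : Matrix.GeneralLinearGroup (Fin n) F) : Type _ :=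
  Module.AEval' (Matrix.toLin' (A : Matrix (Fin n) (Fin n) F))

lemma isConj_of_matrixModule_equiv (A B : Matrix.GeneralLinearGroup (Fin n) F)
    (e : matrixModule A ≃ₗ[Polynomial F] matrixModule B) : IsConj A B := by
  let f : (Fin n → F) ≃ₗ[F] (Fin n → F) :=
    ((Module.AEval'.of _).trans (e.restrictScalars F)).trans (Module.AEval'.of _).symm
  have hf : ∀ v, f (A.1 *ᵥ v) = B.1 *ᵥ f v := by
    intro v
    have h1 := Module.AEval'.X_smul_of (Matrix.toLin' A.1) v
    have h2 := Module.AEval'.of_symm_X_smul (Matrix.toLin' B.1) (e (Module.AEval'.of _ v))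
    rw [← map_smul, h1, Matrix.toLin'_apply, Matrix.toLin'_apply] at h2
    exact h2
  let c : Matrix.GeneralLinearGroup (Fin n) F :=
    ⟨LinearMap.toMatrix' f.toLinearMap, LinearMap.toMatrix' f.symm.toLinearMap,
      by rw [← LinearMap.toMatrix'_comp]; simp, by rw [← LinearMap.toMatrix'_comp]; simp⟩
  have hc : ∀ v, c.1 *ᵥ v = f v := fun v => LinearMap.toMatrix'_mulVec _ v
  rw [isConj_iff]
  refine ⟨c, ?_⟩
  rw [mul_inv_eq_iff_eq_mul]
  ext1
  apply Matrix.toLin'.injective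
  refine LinearMap.ext fun v => ?_
  rw [Matrix.toLin'_apply, Matrix.toLin'_apply, Units.val_mul, Units.val_mul,
    ← Matrix.mulVec_mulVec, ← Matrix.mulVec_mulVec, hc, hc, hf]

lemma matrixModule_equiv_of_isConj (A B : Matrix.GeneralLinearGroup (Fin n) F)
    (h : IsConj A B) : Nonempty (matrixModule A ≃ₗ[Polynomial F] matrixModule B) := by
  obtain ⟨c, hc⟩ := isConj_iff.1 h
  rw [mul_inv_eq_iff_eq_mul] at hc
  let f : (Fin n → F) ≃ₗ[F] (Fin n → F) := LinearEquiv.ofLinearMap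
    (Matrix.toLin' c.1) (Matrix.toLin' c⁻¹.1)
    (by rw [← Matrix.toLin'_mul, ← Units.val_mul, mul_inv_cancel]; simp)
    (by rw [← Matrix.toLin'_mul, ← Units.val_mul, inv_mul_cancel]; simp)
  refine ⟨LinearEquiv.ofAEval _ (f.trans (Module.AEval'.of _)) fun v => ?_⟩
  change Module.AEval'.of _ (c.1 *ᵥ (A.1 *ᵥ v)) = _
  rw [Matrix.mulVec_mulVec, ← Units.val_mul, hc, Units.val_mul, ← Matrix.mulVec_mulVec]
  exact (Module.AEval'.X_smul_of (Matrix.toLin' B.1) (c.1 *ᵥ v)).symm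

/-- Every finite-dimensional `F[X]`-module on which `X` acts injectively is a `matrixModule`. -/
lemma exists_matrixModule_equiv (M : Type*) [AddCommGroup M] [Module F M]
    [Module (Polynomial F) M] [IsScalarTower F (Polynomial F) M] [Module.Finite F M]
    (hn : Module.finrank F M = n)
    (hX : ∀ m : M, (Polynomial.X : Polynomial F) • m = 0 → m = 0) :
    ∃ A : Matrix.GeneralLinearGroup (Fin n) F,
      Nonempty (matrixModule A ≃ₗ[Polynomial F] M) := by
  let e : (Fin n → F) ≃ₗ[F] M := LinearEquiv.ofFinrankEq _ _ (by simp [hn])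
  let x : M →ₗ[F] M := (LinearMap.lsmul (Polynomial F) M Polynomial.X).restrictScalars F
  let φ : (Fin n → F) →ₗ[F] (Fin n → F) := e.symm.toLinearMap ∘ₗ x ∘ₗ e.toLinearMap
  have hφ : Function.Injective φ := by
    rw [injective_iff_map_eq_zero]
    intro v hv
    exact e.map_eq_zero_iff.1 (hX _ (e.symm.map_eq_zero_iff.1 hv))
  have hu : IsUnit (LinearMap.toMatrix' φ) := by
    rw [LinearMap.isUnit_toMatrix'_iff, LinearMap.isUnit_iff_ker_eq_bot]
    exact LinearMap.ker_eq_bot.2 hφ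
  obtain ⟨A, hA⟩ := hu
  refine ⟨A, ⟨LinearEquiv.ofAEval _ e fun v => ?_⟩⟩
  rw [hA, Matrix.toLin'_toMatrix']
  exact e.apply_symm_apply _

/-- Invertibility of the matrix means that `X` acts injectively. -/
lemma matrixModule_X_smul_eq_zero (A : Matrix.GeneralLinearGroup (Fin n) F)
    (m : matrixModule A) (h : (Polynomial.X : Polynomial F) • m = 0) : m = 0 := by
  have h1 := Module.AEval'.of_symm_X_smul (Matrix.toLin' A.1) m
  rw [h, map_zero, Matrix.toLin'_apply] at h1
  have h2 : (A⁻¹).1 *ᵥ (A.1 *ᵥ (Module.AEval'.of (Matrix.toLin' A.1)).symm m) = 0 := by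
    rw [← h1, Matrix.mulVec_zero]
  rw [Matrix.mulVec_mulVec, ← Units.val_mul, inv_mul_cancel, Units.val_one, Matrix.one_mulVec] at h2
  exact (LinearEquiv.map_eq_zero_iff _).1 h2

lemma natCard_matrixModule [Fintype F] (A : Matrix.GeneralLinearGroup (Fin n) F) :
    Nat.card (matrixModule A) = Fintype.card F ^ n := by
  rw [← Nat.card_congr (Module.AEval'.of (Matrix.toLin' A.1)).toEquiv]
  simp

lemma pi_quot_X_smul_eq_zero_iff {N : ℕ} (d : Fin N → Polynomial F) (hd : ∀ i, d i ≠ 0) :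
    (∀ m : (∀ i, Polynomial F ⧸ Ideal.span {d i}),
      (Polynomial.X : Polynomial F) • m = 0 → m = 0) ↔ ∀ i, (d i).coeff 0 ≠ 0 := by
  constructor
  · intro h i hi
    obtain ⟨w, hw⟩ := Polynomial.X_dvd_iff.2 hi
    have h1 := h (Pi.single i (Ideal.Quotient.mk _ w)) (by
      rw [← Pi.single_smul]
      convert Pi.single_zero i
      change Ideal.Quotient.mk _ (Polynomial.X * w) = 0
      rw [Ideal.Quotient.eq_zero_iff_mem, ← hw]
      exact Ideal.mem_span_singleton_self _)
    have h2 : Ideal.Quotient.mk (Ideal.span {d i}) w = 0 := by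
      simpa using congrFun h1 i
    rw [Ideal.Quotient.eq_zero_iff_mem, Ideal.mem_span_singleton, hw] at h2
    have hw0 : w ≠ 0 := by
      rintro rfl
      exact hd i (by rw [hw, mul_zero])
    have := Polynomial.natDegree_le_of_dvd h2 hw0
    rw [Polynomial.natDegree_X_mul hw0] at this
    omega
  · intro h m hm
    ext i
    have hi := congrFun hm i
    obtain ⟨z, hz⟩ := Ideal.Quotient.mk_surjective (m i)
    rw [Pi.smul_apply, ← hz] at hi
    rw [← hz]
    change Ideal.Quotient.mk _ (Polynomial.X * z) = 0 at hi
    change _ = (0 : Polynomial F ⧸ Ideal.span {d i})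
    rw [Ideal.Quotient.eq_zero_iff_mem, Ideal.mem_span_singleton] at hi ⊢
    refine IsCoprime.dvd_of_dvd_mul_left ?_ hi
    refine ((Polynomial.prime_X.coprime_iff_not_dvd).2 ?_).symm
    rw [Polynomial.X_dvd_iff]
    exact h i

end MatrixModules

section InvariantFactors

variable {F : Type*} [Field F]

/-- Monic polynomials with nonzero constant term. -/
abbrev MonicUnitConst (F : Type*) [Field F] : Type _ :=
  {f : Polynomial F // f.Monic ∧ f.coeff 0 ≠ 0}

/-- The chain of invariant factors `dᵢ = ∏_{j ≥ i} fⱼ`. -/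
noncomputable def invariantFactors {N : ℕ} (f : Fin N → MonicUnitConst F) (i : Fin N) :
    Polynomial F :=
  ∏ j ∈ Finset.Ici i, (f j).1

variable {N : ℕ}

lemma invariantFactors_monic (f : Fin N → MonicUnitConst F) (i : Fin N) :
    (invariantFactors f i).Monic :=
  Polynomial.monic_prod_of_monic _ _ fun j _ => (f j).2.1

lemma invariantFactors_coeff_zero (f : Fin N → MonicUnitConst F) (i : Fin N) :
    (invariantFactors f i).coeff 0 ≠ 0 := by
  rw [invariantFactors, Polynomial.coeff_zero_prod]
  exact Finset.prod_ne_zero_iff.2 fun j _ => (f j).2.2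

lemma invariantFactors_dvd (f : Fin N → MonicUnitConst F) (i j : Fin N) (h : i ≤ j) :
    invariantFactors f j ∣ invariantFactors f i :=
  Finset.prod_dvd_prod_of_subset _ _ _ (Finset.Ici_subset_Ici.2 h)

lemma sum_natDegree_invariantFactors (f : Fin N → MonicUnitConst F) :
    ∑ i, (invariantFactors f i).natDegree = ∑ i : Fin N, ((i : ℕ) + 1) * (f i).1.natDegree := by
  have h : ∀ i, (invariantFactors f i).natDegree = ∑ j ∈ Finset.Ici i, (f j).1.natDegree :=
    fun i => Polynomial.natDegree_prod_of_monic _ _ fun j _ => (f j).2.1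
  simp_rw [h]
  rw [Finset.sum_comm' (t' := Finset.univ) (s' := fun j => Finset.Iic j) (by simp)]
  simp [Fin.card_Iic]

lemma invariantFactors_eq_mul (f : Fin N → MonicUnitConst F) (i : Fin N) :
    invariantFactors f i = (f i).1 *
      if h : (i : ℕ) + 1 < N then invariantFactors f ⟨i + 1, h⟩ else 1 := by
  have h1 : Finset.Ici i = insert i (Finset.Ioi i) := by
    ext j
    simp [le_iff_eq_or_lt, eq_comm (a := i)]
  rw [invariantFactors, h1, Finset.prod_insert (by simp)]
  congr 1
  split_ifs with h
  · refine Finset.prod_congr ?_ fun _ _ => rfl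
    ext j
    rw [Finset.mem_Ioi, Finset.mem_Ici, Fin.lt_def, Fin.le_def, Nat.succ_le_iff]
  · refine Finset.prod_eq_one fun j hj => ?_
    have : i < j := Finset.mem_Ioi.1 hj
    have := j.2
    omega

lemma invariantFactors_injective :
    Function.Injective (invariantFactors : (Fin N → MonicUnitConst F) → _) := by
  intro f g h
  ext1 i
  apply Subtype.ext
  have h1 := invariantFactors_eq_mul f i
  rw [h, invariantFactors_eq_mul g i] at h1
  refine (mul_right_cancel₀ ?_ h1).symm
  split_ifs
  · exact (invariantFactors_monic g _).ne_zero
  · exact one_ne_zero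

lemma exists_invariantFactors_eq (d : Fin N → Polynomial F) (hd : ∀ i, (d i).Monic)
    (hc : ∀ i j, i ≤ j → d j ∣ d i) (h0 : ∀ i, (d i).coeff 0 ≠ 0) :
    ∃ f : Fin N → MonicUnitConst F, invariantFactors f = d := by
  have key : ∀ i, ∃ g : MonicUnitConst F,
      d i = g.1 * if h : (i : ℕ) + 1 < N then d ⟨i + 1, h⟩ else 1 := by
    intro i
    split_ifs with h
    · obtain ⟨g, hg⟩ := hc i ⟨i + 1, h⟩ (Nat.le_succ _)
      refine ⟨⟨g, (hd ⟨i + 1, h⟩).of_mul_monic_left (hg ▸ hd i), fun hg0 => h0 i ?_⟩, ?_⟩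
      · rw [hg, Polynomial.mul_coeff_zero, hg0, mul_zero]
      · exact hg.trans (mul_comm _ _)
    · exact ⟨⟨d i, hd i, h0 i⟩, (mul_one _).symm⟩
  choose f hf using key
  have hall : ∀ m : ℕ, ∀ i : Fin N, N ≤ i + m → invariantFactors f i = d i := by
    intro m
    induction m with
    | zero => intro i hi; exact absurd i.2 (by omega)
    | succ m ih =>
      intro i hi
      rw [invariantFactors_eq_mul, hf i]
      congr 1
      split_ifs with h
      · exact ih _ (by simp only; omega)
      · rfl
  exact ⟨f, funext fun i => hall N i (by omega)⟩

lemma ne_zero_of_finite_pi_quot (d : Fin N → Polynomial F)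
    [Finite (∀ i, Polynomial F ⧸ Ideal.span {d i})] (i : Fin N) : d i ≠ 0 := by
  intro h
  have h1 : Finite (Polynomial F ⧸ Ideal.span {d i}) :=
    Finite.of_surjective (fun m : (∀ i, Polynomial F ⧸ Ideal.span {d i}) => m i)
      (Function.surjective_eval i)
  rw [h, Ideal.span_singleton_zero] at h1
  have := Finite.of_injective _ (RingEquiv.quotientBot (Polynomial F)).symm.injective
  exact not_finite (Polynomial F)

lemma isUnit_of_sum_natDegree_le {n : ℕ} (d : Fin N → Polynomial F) (hd : ∀ i, d i ≠ 0)
    (hc : ∀ i j, i ≤ j → d j ∣ d i) (hsum : ∑ i, (d i).natDegree ≤ n)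
    (i : Fin N) (hi : n ≤ i) : IsUnit (d i) := by
  by_contra hu
  have hpos : ∀ j ∈ Finset.Iic i, 1 ≤ (d j).natDegree := by
    intro j hj
    refine le_trans ?_ (Polynomial.natDegree_le_of_dvd (hc j i (Finset.mem_Iic.1 hj)) (hd j))
    rw [Nat.one_le_iff_ne_zero]
    exact fun h => hu (Polynomial.isUnit_iff_degree_eq_zero.2
      (by rw [Polynomial.degree_eq_natDegree (hd i), h]; rfl))
  have h1 := Finset.card_nsmul_le_sum _ _ _ hpos
  have h2 : ∑ j ∈ Finset.Iic i, (d j).natDegree ≤ ∑ j, (d j).natDegree :=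
    Finset.sum_le_sum_of_subset (Finset.subset_univ _)
  simp only [Fin.card_Iic, smul_eq_mul, mul_one] at h1
  omega

/-- Existence of invariant factors for the module of an invertible matrix. -/
lemma exists_matrixModule_equiv_invariantFactors [Fintype F] {n : ℕ} (hN : n ≤ N)
    (A : Matrix.GeneralLinearGroup (Fin n) F) :
    ∃ f : Fin N → MonicUnitConst F, ∑ i : Fin N, ((i : ℕ) + 1) * (f i).1.natDegree = n ∧
      Nonempty (matrixModule A ≃ₗ[Polynomial F]
        (∀ i, Polynomial F ⧸ Ideal.span {invariantFactors f i})) := by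
  classical
  have htor : Module.IsTorsion (Polynomial F) (matrixModule A) :=
    Module.AEval.isTorsion_of_finiteDimensional F (Fin n → F) _
  obtain ⟨ι, _, p, -, e, ⟨e₁⟩⟩ := Module.equiv_directSum_of_isTorsion htor
  let σ := Fintype.equivFin ι
  let c : Fin (Fintype.card ι) → Polynomial F := fun k => p (σ.symm k) ^ e (σ.symm k)
  let e₂ : matrixModule A ≃ₗ[Polynomial F] (∀ k, Polynomial F ⧸ Ideal.span {c k}) :=
    (e₁.trans (DirectSum.linearEquivFunOnFintype _ _ _)).trans
      (LinearEquiv.piCongrLeft' (Polynomial F)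
        (fun i => Polynomial F ⧸ Ideal.span {p i ^ e i}) σ)
  obtain ⟨d, hd, ⟨e₃⟩⟩ := exists_chain_equiv N _ c
  have hcard := natCard_matrixModule A
  have hfin : Finite (matrixModule A) := inferInstanceAs (Finite (Fin n → F))
  have hfin' := Finite.of_equiv _ (e₂.trans e₃).toEquiv
  have hd0 := ne_zero_of_finite_pi_quot d
  have hsum : ∑ i, (d i).natDegree = n := by
    apply Nat.pow_right_injective (Fintype.one_lt_card (α := F))
    simp only
    rw [← natCard_pi_quot d hd0, ← hcard, Nat.card_congr (e₂.trans e₃).toEquiv]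
  obtain ⟨e₄⟩ := nonempty_pi_quot_castLE_equiv (Nat.le_add_right N _) d fun i hi =>
    isUnit_of_sum_natDegree_le d hd0 hd hsum.le i (hN.trans hi)
  let d' : Fin N → Polynomial F := fun i => normalize (d (Fin.castLE (Nat.le_add_right N _) i))
  have hd' : ∀ i, (d' i).Monic := fun i => Polynomial.monic_normalize (hd0 _)
  have hspan : ∀ i : Fin N, Ideal.span {d (Fin.castLE (Nat.le_add_right N _) i)} =
      Ideal.span {d' i} := fun i =>
    Ideal.span_singleton_eq_span_singleton.2 (associated_normalize _)
  let e₅ : matrixModule A ≃ₗ[Polynomial F] (∀ i, Polynomial F ⧸ Ideal.span {d' i}) :=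
    ((e₂.trans e₃).trans e₄).trans
      (LinearEquiv.piCongrRight fun i => Submodule.quotEquivOfEq _ _ (hspan i))
  have hcoeff : ∀ i, (d' i).coeff 0 ≠ 0 := by
    rw [← pi_quot_X_smul_eq_zero_iff d' fun i => (hd' i).ne_zero]
    intro m hm
    rw [← e₅.symm.map_eq_zero_iff]
    apply matrixModule_X_smul_eq_zero A
    rw [← map_smul, hm, map_zero]
  obtain ⟨f, hf⟩ := exists_invariantFactors_eq d' hd'
    (fun i j hij => by simpa [d', normalize_dvd_iff, dvd_normalize_iff] using hd _ _ hij) hcoeff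
  refine ⟨f, ?_, ⟨by rw [hf]; exact e₅⟩⟩
  rw [← sum_natDegree_invariantFactors, hf]
  apply Nat.pow_right_injective (Fintype.one_lt_card (α := F))
  simp only
  rw [← natCard_pi_quot d' fun i => (hd' i).ne_zero, ← hcard, Nat.card_congr e₅.toEquiv]

/-- Conjugacy classes of `GL_n(F)` are parametrized by sequences of polynomials. -/
lemma natCard_conjClasses [Fintype F] {n : ℕ} (hN : n ≤ N) :
    Nat.card (ConjClasses (Matrix.GeneralLinearGroup (Fin n) F)) =
      Nat.card {f : Fin N → MonicUnitConst F //
        ∑ i : Fin N, ((i : ℕ) + 1) * (f i).1.natDegree = n} := by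
  have hex : ∀ f : {f : Fin N → MonicUnitConst F //
        ∑ i : Fin N, ((i : ℕ) + 1) * (f i).1.natDegree = n},
      ∃ A : Matrix.GeneralLinearGroup (Fin n) F, Nonempty (matrixModule A ≃ₗ[Polynomial F]
        (∀ i, Polynomial F ⧸ Ideal.span {invariantFactors f.1 i})) := by
    intro ⟨f, hf⟩
    have h0 := fun i => (invariantFactors_monic f i).ne_zero
    have hfin := fun i => finite_quot (h0 i)
    refine exists_matrixModule_equiv _ ?_
      ((pi_quot_X_smul_eq_zero_iff _ h0).2 (invariantFactors_coeff_zero f))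
    refine Eq.trans ?_ hf
    apply Nat.pow_right_injective (Fintype.one_lt_card (α := F))
    simp only
    rw [← sum_natDegree_invariantFactors, ← natCard_pi_quot _ h0,
      Module.natCard_eq_pow_finrank (K := F), Nat.card_eq_fintype_card]
  choose A hA using hex
  refine (Nat.card_congr (Equiv.ofBijective (fun f => ConjClasses.mk (A f)) ⟨?_, ?_⟩)).symm
  · intro f g hfg
    obtain ⟨e⟩ := matrixModule_equiv_of_isConj _ _ (ConjClasses.mk_eq_mk_iff_isConj.1 hfg)
    obtain ⟨ef⟩ := hA f
    obtain ⟨eg⟩ := hA g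
    exact Subtype.ext (invariantFactors_injective (chain_eq_of_linearEquiv _ _
      (invariantFactors_monic _) (invariantFactors_dvd _) (invariantFactors_monic _)
      (invariantFactors_dvd _) ((ef.symm.trans e).trans eg)))
  · intro C
    induction C using Quotient.inductionOn with
    | h B =>
      obtain ⟨f, hf, ⟨e⟩⟩ := exists_matrixModule_equiv_invariantFactors hN B
      obtain ⟨e'⟩ := hA ⟨f, hf⟩
      exact ⟨⟨f, hf⟩, ConjClasses.mk_eq_mk_iff_isConj.2
        (isConj_of_matrixModule_equiv _ _ (e'.trans e.symm))⟩

end InvariantFactors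

section Counting

lemma coeff_prod_natCard_fiber {ι P : Type*} [Fintype ι] (c : ι → P → ℕ)
    [∀ i m, Finite {p // c i p = m}] (n : ℕ) :
    coeff n (∏ i, PowerSeries.mk fun m => (Nat.card {p // c i p = m} : ℤ)) =
      Nat.card {f : ι → P // ∑ i, c i (f i) = n} := by
  classical
  let φ : (Σ l : {l : ι →₀ ℕ // l ∈ Finset.finsuppAntidiag Finset.univ n},
      ∀ i, {p // c i p = l.1 i}) → {f : ι → P // ∑ i, c i (f i) = n} := fun x =>
    ⟨fun i => (x.2 i).1, by
      rw [Finset.sum_congr rfl fun i _ => (x.2 i).2]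
      exact (Finset.mem_finsuppAntidiag.1 x.1.2).1⟩
  have hφ : Function.Bijective φ := by
    constructor
    · rintro ⟨⟨l, hl⟩, g⟩ ⟨⟨l', hl'⟩, g'⟩ h
      have hg : ∀ i, (g i).1 = (g' i).1 := fun i => congrFun (congrArg Subtype.val h) i
      obtain rfl : l = l' := Finsupp.ext fun i => by
        rw [← (g i).2, ← (g' i).2, hg]
      congr
      exact funext fun i => Subtype.ext (hg i)
    · rintro ⟨f, hf⟩
      refine ⟨⟨⟨Finsupp.equivFunOnFinite.symm fun i => c i (f i), ?_⟩, fun i => ⟨f i, rfl⟩⟩, rfl⟩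
      rw [Finset.mem_finsuppAntidiag]
      exact ⟨hf, Finset.subset_univ _⟩
  rw [← Nat.card_congr (Equiv.ofBijective φ hφ), Nat.card_sigma, PowerSeries.coeff_prod,
    ← Finset.sum_coe_sort]
  push_cast
  refine Finset.sum_congr rfl fun l _ => ?_
  rw [Nat.card_pi]
  push_cast
  exact Finset.prod_congr rfl fun i _ => PowerSeries.coeff_mk _ _

variable {F : Type*} [Field F]

lemma finite_monic_natDegree_eq [Fintype F] (d : ℕ) :
    Finite {p : Polynomial F // p.Monic ∧ p.natDegree = d} :=
  Finite.of_equiv _ ((Polynomial.monicEquivDegreeLT d).trans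
    (Polynomial.degreeLTEquiv F d).toEquiv).symm

lemma natCard_monic_natDegree_eq [Fintype F] (d : ℕ) :
    Nat.card {p : Polynomial F // p.Monic ∧ p.natDegree = d} = Fintype.card F ^ d := by
  rw [Nat.card_congr ((Polynomial.monicEquivDegreeLT d).trans
    (Polynomial.degreeLTEquiv F d).toEquiv)]
  simp

lemma finite_monicUnitConst [Fintype F] (w m : ℕ) (hw : 0 < w) :
    Finite {f : MonicUnitConst F // w * f.1.natDegree = m} := by
  have := finite_monic_natDegree_eq (F := F) (m / w)
  refine Finite.of_injective (β := {p : Polynomial F // p.Monic ∧ p.natDegree = m / w})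
    (fun f => ⟨f.1.1, f.1.2.1, (Nat.div_eq_of_eq_mul_right hw f.2.symm).symm⟩) ?_
  intro f g h
  have h' := congrArg Subtype.val h
  exact Subtype.ext (Subtype.ext h')

lemma natCard_monicUnitConst_zero :
    Nat.card {f : MonicUnitConst F // f.1.natDegree = 0} = 1 := by
  rw [Nat.card_eq_one_iff_unique]
  refine ⟨⟨fun f g => ?_⟩, ⟨⟨⟨1, Polynomial.monic_one, by simp⟩, by simp⟩⟩⟩
  exact Subtype.ext (Subtype.ext (((Polynomial.Monic.natDegree_eq_zero f.1.2.1).1 f.2).trans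
    ((Polynomial.Monic.natDegree_eq_zero g.1.2.1).1 g.2).symm))

lemma natCard_monicUnitConst_succ [Fintype F] (d : ℕ) :
    Nat.card {f : MonicUnitConst F // f.1.natDegree = d + 1} + Fintype.card F ^ d =
      Fintype.card F ^ (d + 1) := by
  classical
  have hfin := finite_monic_natDegree_eq (F := F) (d + 1)
  let S := {p : Polynomial F // p.Monic ∧ p.natDegree = d + 1}
  let e₁ : {f : MonicUnitConst F // f.1.natDegree = d + 1} ≃ {p : S // ¬ p.1.coeff 0 = 0} :=
    { toFun := fun f => ⟨⟨f.1.1, f.1.2.1, f.2⟩, f.1.2.2⟩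
      invFun := fun p => ⟨⟨p.1.1, p.1.2.1, p.2⟩, p.1.2.2⟩
      left_inv := fun _ => rfl
      right_inv := fun _ => rfl }
  let e₂ : {p : Polynomial F // p.Monic ∧ p.natDegree = d} ≃ {p : S // p.1.coeff 0 = 0} :=
    Equiv.ofBijective (fun p => ⟨⟨Polynomial.X * p.1, Polynomial.monic_X.mul p.2.1, by
        rw [Polynomial.natDegree_X_mul p.2.1.ne_zero, p.2.2]⟩, by simp⟩) <| by
      constructor
      · intro p p' h
        exact Subtype.ext (mul_left_cancel₀ Polynomial.X_ne_zero
          (congrArg (fun x => x.1.1) h))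
      · rintro ⟨⟨p, hp, hdeg⟩, h0⟩
        obtain ⟨r, rfl⟩ := Polynomial.X_dvd_iff.2 h0
        have hr : r.Monic := Polynomial.monic_X.of_mul_monic_left hp
        rw [Polynomial.natDegree_X_mul hr.ne_zero] at hdeg
        exact ⟨⟨r, hr, Nat.succ_injective hdeg⟩, rfl⟩
  rw [← natCard_monic_natDegree_eq (F := F) d, ← natCard_monic_natDegree_eq (F := F) (d + 1),
    Nat.card_congr e₁, Nat.card_congr e₂, add_comm, ← Nat.card_sum]
  exact Nat.card_congr (Equiv.sumCompl _)

/-- The generating function of `MonicUnitConst F` by `w` times the degree. -/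
noncomputable def monicSeries (F : Type*) [Field F] (w : ℕ) : PowerSeries ℤ :=
  PowerSeries.mk fun m => (Nat.card {f : MonicUnitConst F // w * f.1.natDegree = m} : ℤ)

lemma coeff_monicSeries_mul (w : ℕ) (hw : 0 < w) (d : ℕ) :
    coeff (w * d) (monicSeries F w) =
      Nat.card {f : MonicUnitConst F // f.1.natDegree = d} := by
  rw [monicSeries, coeff_mk]
  congr 1
  exact Nat.card_congr (Equiv.subtypeEquivRight fun f => Nat.mul_right_inj hw.ne')

lemma coeff_monicSeries_of_not_dvd (w m : ℕ) (h : ¬ w ∣ m) :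
    coeff m (monicSeries F w) = 0 := by
  rw [monicSeries, coeff_mk, Nat.cast_eq_zero]
  have : IsEmpty {f : MonicUnitConst F // w * f.1.natDegree = m} :=
    ⟨fun f => h ⟨_, f.2.symm⟩⟩
  exact Nat.card_of_isEmpty

lemma monicSeries_mul [Fintype F] (w : ℕ) (hw : 0 < w) :
    monicSeries F w * (1 - (Fintype.card F : PowerSeries ℤ) * X ^ w) = 1 - X ^ w := by
  have hq : (Fintype.card F : PowerSeries ℤ) = C (Fintype.card F : ℤ) := by simp
  ext m
  rw [mul_sub, mul_one, mul_left_comm, hq, map_sub, coeff_C_mul, coeff_mul_X_pow', map_sub,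
    coeff_one, coeff_X_pow]
  by_cases hm : w ∣ m
  · obtain ⟨d, rfl⟩ := hm
    rw [coeff_monicSeries_mul w hw]
    obtain _ | d := d
    · rw [natCard_monicUnitConst_zero]
      simp [hw.ne', hw.ne]
    · have h1 : w * (d + 1) - w = w * d := by rw [mul_add, mul_one, Nat.add_sub_cancel]
      rw [if_pos (Nat.le_mul_of_pos_right w d.succ_pos), h1, coeff_monicSeries_mul w hw,
        if_neg (Nat.mul_ne_zero hw.ne' d.succ_ne_zero)]
      have h2 := natCard_monicUnitConst_succ (F := F) d
      obtain _ | d := d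
      · rw [natCard_monicUnitConst_zero]
        zify at h2
        simp at h2 ⊢
        linarith
      · have h3 := natCard_monicUnitConst_succ (F := F) d
        have h4 : w * (d + 1 + 1) ≠ w := by nlinarith
        rw [if_neg h4]
        replace h2 := congrArg (Nat.cast : ℕ → ℤ) h2
        replace h3 := congrArg (Nat.cast : ℕ → ℤ) h3
        simp only [Nat.cast_add (R := ℤ), Nat.cast_pow] at h2 h3
        linear_combination h2 - (Fintype.card F : ℤ) * h3
  · have hm0 : m ≠ 0 := by
      rintro rfl
      exact hm (dvd_zero w)
    have hmw : m ≠ w := by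
      rintro rfl
      exact hm dvd_rfl
    rw [coeff_monicSeries_of_not_dvd w m hm, if_neg hm0, if_neg hmw]
    split_ifs with h
    · rw [coeff_monicSeries_of_not_dvd w (m - w) fun h' => hm ((Nat.dvd_sub_iff_left h dvd_rfl).1 h')]
      simp
    · simp

lemma factor_eq_monicSeries [Fintype F] (w : ℕ) (hw : 0 < w) :
    (1 - X ^ w) * inv1 (1 - (Fintype.card F : PowerSeries ℤ) * X ^ w) = monicSeries F w := by
  rw [← monicSeries_mul (F := F) w hw, mul_assoc, inv1, mul_invOfUnit, mul_one]
  simp [hw.ne']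

end Counting

/-- If `F` is a finite field with `q` elements and `k(n,q)` denotes the number of conjugacy
classes of `GL_n(F)`, then in `ℤ⟦X⟧`,
`1 + ∑_{n=1}^∞ k(n,q) Xⁿ = ∏_{l=1}^∞ (1 − X^l)·(1 − qX^l)⁻¹`. -/
theorem conjugacy_classes_GL_generating_function
    (F : Type*) [Field F] [Fintype F] (q : ℕ) (hq : Fintype.card F = q) :
    Tendsto (fun N : ℕ => ∏ l ∈ Finset.range N,
        ((1 - (X : PowerSeries ℤ) ^ (l + 1)) *
          inv1 (1 - (q : PowerSeries ℤ) * (X : PowerSeries ℤ) ^ (l + 1))))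
      atTop
      (nhds (PowerSeries.mk fun n => if n = 0 then 1 else
        (Nat.card (ConjClasses (Matrix.GeneralLinearGroup (Fin n) F)) : ℤ))) := by
  subst hq
  have hcoeff : ∀ n N : ℕ, n ≤ N → coeff n (∏ l ∈ Finset.range N,
      ((1 - (X : PowerSeries ℤ) ^ (l + 1)) *
        inv1 (1 - (Fintype.card F : PowerSeries ℤ) * (X : PowerSeries ℤ) ^ (l + 1)))) =
      coeff n (PowerSeries.mk fun n => if n = 0 then 1 else
        (Nat.card (ConjClasses (Matrix.GeneralLinearGroup (Fin n) F)) : ℤ)) := by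
    intro n N hN
    have := fun (i : Fin N) m => finite_monicUnitConst (F := F) (i + 1) m (Nat.succ_pos _)
    rw [Finset.prod_congr rfl fun l _ => factor_eq_monicSeries (F := F) (l + 1) l.succ_pos,
      Finset.prod_range]
    refine (coeff_prod_natCard_fiber
      (fun (i : Fin N) (f : MonicUnitConst F) => ((i : ℕ) + 1) * f.1.natDegree) n).trans ?_
    rw [← natCard_conjClasses hN, coeff_mk]
    split_ifs with h
    · subst h
      have : Subsingleton (ConjClasses (Matrix.GeneralLinearGroup (Fin 0) F)) :=
        ConjClasses.mk_surjective.subsingleton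
      simp [Nat.card_unique, -Nat.card_eq_fintype_card]
    · rfl
  refine tendsto_pi_nhds.2 fun m => ?_
  obtain ⟨n, rfl⟩ : ∃ n, m = Finsupp.single () n := ⟨m (), by ext; simp⟩
  refine tendsto_nhds_of_eventually_eq ?_
  filter_upwards [eventually_ge_atTop n] with N hN
  exact hcoeff n N hN
end

section
/- The Erdős–Turán theorem: for all integers n, d ≥ 1, the number of permutations σ of {1,…,n} such that no cycle length of σ is divisible by d (where the cycle lengths of σ are the sizes of the orbits of σ, fixed points counting as cycles of length 1) equals n! · ∏_{k=1}^{⌊n/d⌋} (kd − 1)/(kd), an identity of rational numbers. -/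
open Equiv MulAction

theorem orbit_zpowers_of_semiconj {α β : Type*} {σ : Perm α} {τ : Perm β} {g : β → α}
    (h : ∀ x, σ (g x) = g (τ x)) (x : β) :
    orbit (Subgroup.zpowers σ) (g x) = g '' orbit (Subgroup.zpowers τ) x := by
  have hinv : ∀ x, σ⁻¹ (g x) = g (τ⁻¹ x) := fun x => by
    rw [Perm.inv_eq_iff_eq, h]; simp
  have key : ∀ (i : ℤ) (x : β), (σ ^ i) (g x) = g ((τ ^ i) x) := by
    intro i
    induction i with
    | zero => simp
    | succ i ih => intro x; simp only [zpow_add_one, Perm.mul_apply, h, ih]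
    | pred i ih => intro x; simp only [zpow_sub_one, Perm.mul_apply, hinv, ih]
  ext y
  constructor
  · rintro ⟨⟨_, i, rfl⟩, rfl⟩
    exact ⟨(τ ^ i) x, ⟨⟨_, i, rfl⟩, rfl⟩, (key i x).symm⟩
  · rintro ⟨_, ⟨⟨_, i, rfl⟩, rfl⟩, rfl⟩
    exact ⟨⟨_, i, rfl⟩, key i x⟩

theorem card_orbit_zpowers_of_semiconj {α β : Type*} {σ : Perm α} {τ : Perm β} {g : β → α}
    (hg : g.Injective) (h : ∀ x, σ (g x) = g (τ x)) (x : β) :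
    Nat.card (orbit (Subgroup.zpowers σ) (g x)) = Nat.card (orbit (Subgroup.zpowers τ) x) := by
  rw [orbit_zpowers_of_semiconj h, Nat.card_image_of_injective hg]

/-- The number of permutations of `α` all of whose cycle lengths lie in `L`. -/
noncomputable def cardPermCycleLengths (L : Set ℕ) (α : Type*) : ℕ :=
  Nat.card {σ : Perm α // ∀ x : α, Nat.card (orbit (Subgroup.zpowers σ) x) ∈ L}

/-- The number of permutations of `α` acting transitively. -/
noncomputable def cardTransitivePerm (α : Type*) : ℕ :=
  Nat.card {σ : Perm α // ∀ x : α, orbit (Subgroup.zpowers σ) x = Set.univ}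

theorem cardPermCycleLengths_congr (L : Set ℕ) {α β : Type*} (e : α ≃ β) :
    cardPermCycleLengths L α = cardPermCycleLengths L β := by
  refine Nat.card_congr (e.permCongr.subtypeEquiv fun σ => ?_)
  rw [← e.forall_congr_right]
  refine forall_congr' fun x => ?_
  rw [card_orbit_zpowers_of_semiconj (τ := σ) e.injective (by simp)]

theorem cardTransitivePerm_congr {α β : Type*} (e : α ≃ β) :
    cardTransitivePerm α = cardTransitivePerm β := by
  refine Nat.card_congr (e.permCongr.subtypeEquiv fun σ => ?_)
  rw [← e.forall_congr_right]
  refine forall_congr' fun x => ?_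
  rw [orbit_zpowers_of_semiconj (τ := σ) (g := e) (by simp), ← Set.image_univ_of_surjective e.surjective,
    e.injective.image_injective.eq_iff]

theorem card_perm_with_orbit_eq (L : Set ℕ) {α : Type*} {S : Set α} {a : α} (ha : a ∈ S)
    (hS : Nat.card S ∈ L) :
    Nat.card {σ : Perm α // (∀ x : α, Nat.card (orbit (Subgroup.zpowers σ) x) ∈ L) ∧
      orbit (Subgroup.zpowers σ) a = S} =
    cardTransitivePerm {x // x ∈ S} * cardPermCycleLengths L {x // x ∉ S} := by
  classical
  rw [cardTransitivePerm, cardPermCycleLengths, ← Nat.card_prod]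
  symm
  have h₁ (τ : Perm {x // x ∈ S}) (ρ : Perm {x // x ∉ S}) (x : {x // x ∈ S}) :
      τ.subtypeCongr ρ x = (τ x : α) := by simp
  have h₂ (τ : Perm {x // x ∈ S}) (ρ : Perm {x // x ∉ S}) (x : {x // x ∉ S}) :
      τ.subtypeCongr ρ x = (ρ x : α) := by simp
  refine Nat.card_congr (Equiv.ofBijective (fun p => ⟨p.1.1.subtypeCongr p.2.1, ?_, ?_⟩) ⟨?_, ?_⟩)
  · intro x
    by_cases hx : x ∈ S
    · rw [card_orbit_zpowers_of_semiconj Subtype.val_injective (h₁ p.1.1 p.2.1) ⟨x, hx⟩, p.1.2]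
      simpa using hS
    · rw [card_orbit_zpowers_of_semiconj Subtype.val_injective (h₂ p.1.1 p.2.1) ⟨x, hx⟩]
      exact p.2.2 _
  · rw [orbit_zpowers_of_semiconj (h₁ p.1.1 p.2.1) ⟨a, ha⟩, p.1.2]
    simp
  · rintro ⟨⟨τ, hτ⟩, ⟨ρ, hρ⟩⟩ ⟨⟨τ', hτ'⟩, ⟨ρ', hρ'⟩⟩ h
    have := Perm.subtypeCongrHom_injective (· ∈ S) (a₁ := (τ, ρ)) (a₂ := (τ', ρ'))
      (Subtype.ext_iff.1 h)
    simpa [Subtype.ext_iff] using this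
  · rintro ⟨σ, hσ, rfl⟩
    have hmem (x : α) :
        σ x ∈ orbit (Subgroup.zpowers σ) a ↔ x ∈ orbit (Subgroup.zpowers σ) a := by
      rw [← orbit_eq_iff, ← orbit_eq_iff,
        ← orbit_smul (⟨σ, Subgroup.mem_zpowers σ⟩ : Subgroup.zpowers σ) x]
      rfl
    refine ⟨⟨⟨σ.subtypePerm hmem, fun x => ?_⟩,
      ⟨σ.subtypePerm fun x => not_congr (hmem x), fun x => ?_⟩⟩, ?_⟩
    · rw [← Subtype.val_injective.image_injective.eq_iff,
        ← orbit_zpowers_of_semiconj (σ := σ) (by simp), orbit_eq_iff.2 x.2]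
      simp
    · rw [← card_orbit_zpowers_of_semiconj (σ := σ) Subtype.val_injective (by simp)]
      exact hσ _
    · ext x
      by_cases hx : x ∈ orbit (Subgroup.zpowers σ) a
      · simp [Perm.subtypeCongr.left_apply, hx]
      · simp [Perm.subtypeCongr.right_apply, hx]

theorem card_perm_with_orbit_eq_zero {L : Set ℕ} {α : Type*} {S : Set α} {a : α}
    (hS : Nat.card S ∉ L) :
    Nat.card {σ : Perm α // (∀ x : α, Nat.card (orbit (Subgroup.zpowers σ) x) ∈ L) ∧
      orbit (Subgroup.zpowers σ) a = S} = 0 := by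
  have : IsEmpty {σ : Perm α // (∀ x : α, Nat.card (orbit (Subgroup.zpowers σ) x) ∈ L) ∧
      orbit (Subgroup.zpowers σ) a = S} := ⟨by rintro ⟨σ, h, rfl⟩; exact hS (h a)⟩
  exact Nat.card_of_isEmpty

open Classical in
theorem cardPermCycleLengths_succ (L : Set ℕ) (n : ℕ) :
    cardPermCycleLengths L (Fin (n + 1)) = ∑ j ∈ Finset.range (n + 1), n.choose j *
      if j + 1 ∈ L then cardTransitivePerm (Fin (j + 1)) * cardPermCycleLengths L (Fin (n - j))
      else 0 := by
  have hpow := Finset.sum_powerset_apply_card (fun j => if j + 1 ∈ L then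
    cardTransitivePerm (Fin (j + 1)) * cardPermCycleLengths L (Fin (n - j)) else 0)
    (x := (Finset.univ : Finset (Fin (n + 1))).erase 0)
  simp only [Finset.card_erase_of_mem (Finset.mem_univ _), Finset.card_univ, Fintype.card_fin,
    Nat.add_sub_cancel, smul_eq_mul] at hpow
  rw [← hpow, cardPermCycleLengths, Nat.card_eq_fintype_card, Fintype.card_subtype,
    Finset.card_eq_sum_card_fiberwise
      (f := fun σ => (orbit (Subgroup.zpowers σ) (0 : Fin (n + 1))).toFinset.erase 0)
      (t := (Finset.univ.erase 0).powerset)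
      (fun σ _ => Finset.mem_powerset.2 (Finset.erase_subset_erase _ (Finset.subset_univ _)))]
  refine Finset.sum_congr rfl fun T hT => ?_
  have h0 : (0 : Fin (n + 1)) ∉ T := fun h => by simpa using Finset.mem_powerset.1 hT h
  have hcard : Nat.card ((insert 0 T : Finset (Fin (n + 1))) : Set (Fin (n + 1))) = T.card + 1 := by
    rw [← Finset.card_insert_of_notMem h0]; simp
  have hfib : Finset.card {σ ∈ ({σ | ∀ x : Fin (n + 1), Nat.card (orbit (Subgroup.zpowers σ) x) ∈ L} :
        Finset (Perm (Fin (n + 1)))) |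
        (orbit (Subgroup.zpowers σ) (0 : Fin (n + 1))).toFinset.erase 0 = T} =
      Nat.card {σ : Perm (Fin (n + 1)) // (∀ x : Fin (n + 1), Nat.card (orbit (Subgroup.zpowers σ) x) ∈ L) ∧
        orbit (Subgroup.zpowers σ) 0 = ((insert 0 T : Finset (Fin (n + 1))) : Set (Fin (n + 1)))} := by
    rw [Nat.card_eq_fintype_card, Fintype.card_subtype, Finset.filter_filter]
    congr 1
    refine Finset.filter_congr fun σ _ => and_congr_right fun _ => ?_
    rw [Finset.erase_eq_iff_eq_insert (by simp [mem_orbit_self]) h0, ← Finset.coe_inj, Set.coe_toFinset]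
  rw [hfib]
  split_ifs with hL
  · rw [card_perm_with_orbit_eq L (by simp) (by rwa [hcard])]
    congr 1
    · refine cardTransitivePerm_congr (Fintype.equivFinOfCardEq ?_)
      rw [← Nat.card_eq_fintype_card]; exact hcard
    · refine cardPermCycleLengths_congr L (Fintype.equivFinOfCardEq ?_)
      rw [Fintype.card_subtype_compl, Fintype.card_fin, ← Nat.add_sub_add_right n 1]
      congr 1
      rw [← Nat.card_eq_fintype_card]
      exact hcard
  · rw [card_perm_with_orbit_eq_zero (by rwa [hcard])]

theorem cardTransitivePerm_fin_succ (n : ℕ) : cardTransitivePerm (Fin (n + 1)) = n.factorial := by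
  have huniv (m : ℕ) : cardPermCycleLengths Set.univ (Fin m) = m.factorial := by
    simp [cardPermCycleLengths, Fintype.card_perm, Nat.card_eq_fintype_card]
  induction n using Nat.strong_induction_on with
  | _ n ih =>
    have h := cardPermCycleLengths_succ Set.univ n
    simp only [huniv, Set.mem_univ, if_true, Finset.sum_range_succ] at h
    rw [Finset.sum_congr rfl (g := fun _ => n.factorial) fun j hj => by
      rw [ih j (Finset.mem_range.1 hj), ← mul_assoc,
        Nat.choose_mul_factorial_mul_factorial (Finset.mem_range.1 hj).le]] at h
    simp [Nat.factorial_succ, add_mul] at h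
    omega

open Classical in
theorem succ_mul_cardPermCycleLengths_div_factorial (L : Set ℕ) (n : ℕ) :
    ((n + 1 : ℕ) : ℚ) * (cardPermCycleLengths L (Fin (n + 1)) / (n + 1).factorial) =
      ∑ i ∈ Finset.range (n + 1),
        if n + 1 - i ∈ L then (cardPermCycleLengths L (Fin i) : ℚ) / i.factorial else 0 := by
  rw [cardPermCycleLengths_succ, ← Finset.sum_range_reflect (n := n + 1), Nat.factorial_succ]
  have hn : (n.factorial : ℚ) ≠ 0 := by positivity
  have hn' : ((n + 1 : ℕ) : ℚ) ≠ 0 := by positivity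
  push_cast at hn' ⊢
  rw [← mul_div_assoc, mul_div_mul_left _ _ hn', Finset.sum_div]
  refine Finset.sum_congr rfl fun i hi => ?_
  have hi : i ≤ n := Nat.lt_succ_iff.1 (Finset.mem_range.1 hi)
  rw [Nat.sub_sub_self hi, ← Nat.sub_add_comm hi]
  split_ifs with h
  · rw [Nat.sub_add_comm hi, cardTransitivePerm_fin_succ, Nat.choose_symm hi,
      ← Nat.choose_mul_factorial_mul_factorial hi]
    have := Nat.choose_pos hi
    push_cast
    field_simp
  · simp

/-- The product `∏_{k=1}^m (kd − 1)/(kd)`. -/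
noncomputable def erdosTuranProd (d m : ℕ) : ℚ :=
  ∏ k ∈ Finset.Icc 1 m, (((k : ℚ) * d - 1) / ((k : ℚ) * d))

theorem sum_erdosTuranProd {d : ℕ} (hd : 1 ≤ d) (n : ℕ) :
    ∑ i ∈ Finset.range n, erdosTuranProd d (i / d) =
      n * erdosTuranProd d (n / d) + ∑ m ∈ Finset.range (n / d), erdosTuranProd d m := by
  induction n with
  | zero => simp
  | succ n ih =>
    rw [Finset.sum_range_succ, ih, Nat.succ_div]
    split_ifs with h
    · obtain ⟨k, hk⟩ := h
      have hkd : k = n / d + 1 := by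
        rw [← Nat.succ_div_of_dvd ⟨k, hk⟩, hk, Nat.mul_div_cancel_left _ hd]
      have hP : erdosTuranProd d (n / d + 1) = erdosTuranProd d (n / d) * (n / (n + 1)) := by
        have hdk : ((n / d + 1 : ℕ) : ℚ) * d = n + 1 := by
          rw [← hkd, mul_comm]
          exact_mod_cast hk.symm
        rw [erdosTuranProd, Finset.prod_Icc_succ_top (Nat.le_add_left 1 _), ← erdosTuranProd, hdk,
          add_sub_cancel_right]
      rw [Finset.sum_range_succ, hP]
      push_cast
      field_simp
      ring
    · push_cast; simp; ring

theorem sum_dvd_erdosTuranProd {d : ℕ} (hd : 1 ≤ d) (n : ℕ) :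
    (∑ i ∈ Finset.range n, if d ∣ n - i then erdosTuranProd d (i / d) else 0) =
      ∑ m ∈ Finset.range (n / d), erdosTuranProd d m := by
  rw [← Finset.sum_filter]
  symm
  have hn := Nat.div_add_mod n d
  have hdiv (m : ℕ) : (d * m + n % d) / d = m := by
    rw [Nat.mul_add_div hd, Nat.div_eq_of_lt (Nat.mod_lt n hd), add_zero]
  refine Finset.sum_bij' (fun m _ => d * m + n % d) (fun i _ => i / d) ?_ ?_ ?_ ?_ ?_
  · intro m hm
    have hm := Finset.mem_range.1 hm
    have hlt : d * m < d * (n / d) := Nat.mul_lt_mul_of_pos_left hm hd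
    rw [Finset.mem_filter, Finset.mem_range]
    refine ⟨by omega, n / d - m, ?_⟩
    rw [Nat.mul_sub]
    omega
  · intro i hi
    obtain ⟨hi, k, hk⟩ := Finset.mem_filter.1 hi
    have hi := Finset.mem_range.1 hi
    obtain rfl : n = i + d * k := by omega
    have hk : 0 < k := Nat.pos_of_ne_zero fun h => by simp [h] at hi
    rw [Finset.mem_range, Nat.add_mul_div_left _ _ hd]
    omega
  · exact fun m _ => hdiv m
  · intro i hi
    obtain ⟨hi, k, hk⟩ := Finset.mem_filter.1 hi
    have hi := Finset.mem_range.1 hi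
    obtain rfl : n = i + d * k := by omega
    rw [Nat.add_mul_mod_self_left, Nat.div_add_mod]
  · exact fun m _ => by rw [hdiv]

theorem cardPermCycleLengths_not_dvd_div_factorial {d : ℕ} (hd : 1 ≤ d) (n : ℕ) :
    (cardPermCycleLengths {l | ¬ d ∣ l} (Fin n) : ℚ) / n.factorial = erdosTuranProd d (n / d) := by
  induction n using Nat.strong_induction_on with
  | _ n ih =>
    obtain _ | n := n
    · simp [cardPermCycleLengths, erdosTuranProd]
    · have hn : ((n + 1 : ℕ) : ℚ) ≠ 0 := by positivity
      refine mul_left_cancel₀ hn ?_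
      rw [succ_mul_cardPermCycleLengths_div_factorial,
        ← add_right_cancel_iff (a := ∑ m ∈ Finset.range ((n + 1) / d), erdosTuranProd d m),
        ← sum_erdosTuranProd hd, ← sum_dvd_erdosTuranProd hd, ← Finset.sum_add_distrib]
      refine Finset.sum_congr rfl fun i hi => ?_
      rw [ih i (Finset.mem_range.1 hi)]
      by_cases h : d ∣ n + 1 - i <;> simp [h]

/-- **Erdős–Turán**: the number of permutations of `{1, …, n}` none of whose cycle lengths
(i.e. sizes of orbits, fixed points counting as cycles of length 1) is divisible by `d`
equals `n! · ∏_{k=1}^{⌊n/d⌋} (kd − 1)/(kd)`. -/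
theorem erdos_turan_cycle_lengths (n d : ℕ) (hn : 1 ≤ n) (hd : 1 ≤ d) :
    (Nat.card {σ : Equiv.Perm (Fin n) //
        ∀ x : Fin n, ¬ d ∣ Nat.card (MulAction.orbit (Subgroup.zpowers σ) x)} : ℚ) =
      (n.factorial : ℚ) *
        ∏ k ∈ Finset.Icc 1 (n / d), (((k : ℚ) * d - 1) / ((k : ℚ) * d)) := by
  have h := cardPermCycleLengths_not_dvd_div_factorial hd n
  rw [div_eq_iff (by positivity), mul_comm] at h
  exact h
end

section
/- The Lagrange–Jacobi four-square theorem (Jacobi's counting form): for every integer n ≥ 1, the set {(a,b,c,d) ∈ ℤ⁴ : a² + b² + c² + d² = n} is finite and its cardinality equals 8 · ∑ d, the sum ranging over all positive divisors d of n that are not divisible by 4. -/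
open Finset

/-- Triples `(i, d, δ)` with `d, δ > 0` and `i² + c² d δ = n`. -/
noncomputable def simpleForms (c n : ℤ) : Finset (ℤ × ℤ × ℤ) :=
  (Icc (-n) n ×ˢ Icc 1 n ×ˢ Icc 1 n).filter fun t => t.1 ^ 2 + c ^ 2 * (t.2.1 * t.2.2) = n

theorem mem_simpleForms {c n i d δ : ℤ} (hc : 0 < c) :
    (i, d, δ) ∈ simpleForms c n ↔ 0 < d ∧ 0 < δ ∧ i ^ 2 + c ^ 2 * (d * δ) = n := by
  simp only [simpleForms, mem_filter, mem_product, mem_Icc]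
  constructor
  · rintro ⟨⟨-, ⟨h1, -⟩, h2, -⟩, h⟩
    exact ⟨by lia, by lia, h⟩
  · rintro ⟨h1, h2, h⟩
    have hdδ : 0 < d * δ := mul_pos h1 h2
    have hc2 : 1 ≤ c ^ 2 := by nlinarith
    have hle : d * δ ≤ c ^ 2 * (d * δ) := by nlinarith
    have hi : 0 ≤ i ^ 2 := sq_nonneg i
    have hi1 : i ≤ i ^ 2 := Int.le_self_sq i
    have hi2 : -i ≤ i ^ 2 := by simpa using Int.le_self_sq (-i)
    refine ⟨⟨⟨by lia, by lia⟩, ⟨by lia, ?_⟩, by lia, ?_⟩, h⟩ <;> nlinarith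

theorem sum_simpleForms_swap {c n : ℤ} (hc : 0 < c) (F : ℤ × ℤ × ℤ → ℤ) :
    ∑ t ∈ simpleForms c n, F (t.1, t.2.2, t.2.1) = ∑ t ∈ simpleForms c n, F t := by
  refine sum_nbij' (fun t => (t.1, t.2.2, t.2.1)) (fun t => (t.1, t.2.2, t.2.1)) ?_ ?_ ?_ ?_ ?_
  · rintro ⟨i, d, δ⟩ h
    rw [mem_simpleForms hc] at h ⊢
    exact ⟨h.2.1, h.1, by linear_combination h.2.2⟩
  · rintro ⟨i, d, δ⟩ h
    rw [mem_simpleForms hc] at h ⊢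
    exact ⟨h.2.1, h.1, by linear_combination h.2.2⟩
  all_goals simp

theorem sum_simpleForms_neg {c n : ℤ} (hc : 0 < c) (F : ℤ × ℤ × ℤ → ℤ) :
    ∑ t ∈ simpleForms c n, F (-t.1, t.2) = ∑ t ∈ simpleForms c n, F t := by
  refine sum_nbij' (fun t => (-t.1, t.2)) (fun t => (-t.1, t.2)) ?_ ?_ ?_ ?_ ?_
  · rintro ⟨i, d, δ⟩ h
    rw [mem_simpleForms hc] at h ⊢
    simpa using h
  · rintro ⟨i, d, δ⟩ h
    rw [mem_simpleForms hc] at h ⊢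
    simpa using h
  all_goals simp

/-- A cubic weight that is anti-invariant under the involution
`(i, d, δ) ↦ (-(i + c d), d, δ - e i - d)`, where `c e = 2`. -/
def cubicWeight (e : ℤ) (t : ℤ × ℤ × ℤ) : ℤ :=
  (t.2.1 + t.2.2) * (t.2.1 + e * t.1) * (t.2.2 - e * t.1)

theorem sum_cubicWeight_upper {c e n : ℤ} (hc : 0 < c) (hce : c * e = 2) :
    ∑ t ∈ simpleForms c n with t.2.1 + e * t.1 < t.2.2, cubicWeight e t = 0 := by
  have key : ∑ t ∈ simpleForms c n with t.2.1 + e * t.1 < t.2.2, cubicWeight e t =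
      ∑ t ∈ simpleForms c n with t.2.1 + e * t.1 < t.2.2, - cubicWeight e t := by
    have maps : ∀ t ∈ (simpleForms c n).filter (fun t => t.2.1 + e * t.1 < t.2.2),
        (-(t.1 + c * t.2.1), t.2.1, t.2.2 - e * t.1 - t.2.1) ∈
          (simpleForms c n).filter (fun t => t.2.1 + e * t.1 < t.2.2) := by
      rintro ⟨i, d, δ⟩ h
      simp only [mem_filter, mem_simpleForms hc] at h ⊢
      obtain ⟨⟨h1, h2, h3⟩, h4⟩ := h
      refine ⟨⟨h1, by lia, ?_⟩, ?_⟩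
      · linear_combination h3 - c * i * d * hce
      · linear_combination h2 - d * hce
    refine sum_nbij' (fun t => (-(t.1 + c * t.2.1), t.2.1, t.2.2 - e * t.1 - t.2.1))
      (fun t => (-(t.1 + c * t.2.1), t.2.1, t.2.2 - e * t.1 - t.2.1)) maps maps ?_ ?_ ?_
    · rintro ⟨i, d, δ⟩ -
      simp only [Prod.mk.injEq, true_and]
      exact ⟨by ring, by linear_combination d * hce⟩
    · rintro ⟨i, d, δ⟩ -
      simp only [Prod.mk.injEq, true_and]
      exact ⟨by ring, by linear_combination d * hce⟩
    · rintro ⟨i, d, δ⟩ -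
      have h1 : d + e * -(i + c * d) = -(d + e * i) := by linear_combination -d * hce
      have h2 : δ - e * i - d - e * -(i + c * d) = d + δ := by linear_combination d * hce
      simp only [cubicWeight, h1, h2]
      ring
  rw [sum_neg_distrib] at key
  lia

theorem sum_cubicWeight_lower {c e n : ℤ} (hc : 0 < c) (hce : c * e = 2) :
    ∑ t ∈ simpleForms c n with t.2.2 < t.2.1 + e * t.1, cubicWeight e t = 0 := by
  rw [← sum_cubicWeight_upper (n := n) hc hce]
  refine sum_nbij' (fun t => (-t.1, t.2.2, t.2.1)) (fun t => (-t.1, t.2.2, t.2.1)) ?_ ?_ ?_ ?_ ?_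
  · rintro ⟨i, d, δ⟩ h
    simp only [mem_filter, mem_simpleForms hc] at h ⊢
    obtain ⟨⟨h1, h2, h3⟩, h4⟩ := h
    exact ⟨⟨h2, h1, by linear_combination h3⟩, by linear_combination h4⟩
  · rintro ⟨i, d, δ⟩ h
    simp only [mem_filter, mem_simpleForms hc] at h ⊢
    obtain ⟨⟨h1, h2, h3⟩, h4⟩ := h
    exact ⟨⟨h2, h1, by linear_combination h3⟩, by linear_combination h4⟩
  · simp
  · simp
  · rintro ⟨i, d, δ⟩ -
    simp only [cubicWeight]
    ring

theorem sum_cubicWeight {c e n : ℤ} (hc : 0 < c) (hce : c * e = 2) :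
    ∑ t ∈ simpleForms c n, cubicWeight e t =
      ∑ t ∈ simpleForms c n with t.2.2 = t.2.1 + e * t.1, cubicWeight e t := by
  rw [← sum_filter_add_sum_filter_not _ (fun t => t.2.2 = t.2.1 + e * t.1), add_eq_left,
    ← sum_filter_add_sum_filter_not _ (fun t => t.2.2 < t.2.1 + e * t.1), filter_filter,
    filter_filter, ← add_zero (0 : ℤ)]
  nth_rw 1 [← sum_cubicWeight_lower (n := n) hc hce]
  rw [← sum_cubicWeight_upper (n := n) hc hce]
  congr 2 <;> ext t <;> simp only [mem_filter] <;> lia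

theorem sum_mul_sub (K : ℕ) : 6 * ∑ d ∈ Ioo (0 : ℤ) K, d * (K - d) = K * (K ^ 2 - 1) := by
  have h (m : ℕ) (x : ℤ) :
      6 * ∑ d ∈ Ioo (0 : ℤ) (m + 1), d * (x - d) =
        3 * x * m * (m + 1) - m * (m + 1) * (2 * m + 1) := by
    induction m with
    | zero => simp [show Ioo (0 : ℤ) 1 = ∅ from rfl]
    | succ m ih =>
      have : Ioo (0 : ℤ) ((m + 1 : ℕ) + 1) = insert (m + 1 : ℤ) (Ioo (0 : ℤ) (m + 1)) := by
        ext d; simp only [mem_Ioo, mem_insert]; lia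
      rw [this, sum_insert (by simp), mul_add, ih]
      push_cast
      ring
  cases K with
  | zero => simp
  | succ m =>
    push_cast
    rw [h]
    ring

theorem add_mul_eq_of_boundary {c e k i d : ℤ} (he : 0 < e) (hce : c * e = 2) (hk : 0 < k)
    (h1 : 0 < d) (h2 : 0 < d + e * i) (h3 : i ^ 2 + c ^ 2 * (d * (d + e * i)) = k ^ 2) :
    i + c * d = k := by
  have hkk : (i + c * d) ^ 2 = k ^ 2 := by linear_combination h3 - c * i * d * hce
  have hpos : 0 < e * (i + c * d) := by linear_combination h1 + h2 - d * hce
  exact (sq_eq_sq₀ (pos_of_mul_pos_right hpos he.le).le hk.le).1 hkk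

theorem sum_cubicWeight_sq {c e k : ℤ} (hc : 0 < c) (he : 0 < e) (hce : c * e = 2) (hk : 0 < k) :
    6 * ∑ t ∈ simpleForms c (k ^ 2), cubicWeight e t = (e * k) ^ 2 * ((e * k) ^ 2 - 1) := by
  obtain ⟨K, hK⟩ := Int.eq_ofNat_of_zero_le (mul_pos he hk).le
  have : ∑ t ∈ simpleForms c (k ^ 2), cubicWeight e t = K * ∑ d ∈ Ioo (0 : ℤ) K, d * (K - d) := by
    rw [sum_cubicWeight hc hce, mul_sum, ← hK]
    refine sum_nbij' (fun t => t.2.1) (fun d => (k - c * d, d, e * k - d)) ?_ ?_ ?_ ?_ ?_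
    · rintro ⟨i, d, δ⟩ h
      simp only [mem_filter, mem_simpleForms hc, mem_Ioo] at h ⊢
      obtain ⟨⟨h1, h2, h3⟩, rfl⟩ := h
      have hki := add_mul_eq_of_boundary he hce hk h1 h2 h3
      refine ⟨h1, ?_⟩
      rw [← hki]
      linear_combination h2 - d * hce
    · intro d h
      simp only [mem_filter, mem_simpleForms hc, mem_Ioo] at h ⊢
      refine ⟨⟨h.1, by lia, ?_⟩, ?_⟩
      · linear_combination c * d * k * hce
      · linear_combination d * hce
    · rintro ⟨i, d, δ⟩ h
      simp only [mem_filter, mem_simpleForms hc, Prod.mk.injEq, true_and] at h ⊢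
      obtain ⟨⟨h1, h2, h3⟩, rfl⟩ := h
      have hki := add_mul_eq_of_boundary he hce hk h1 h2 h3
      rw [← hki]
      exact ⟨by ring, by linear_combination d * hce⟩
    · simp
    · rintro ⟨i, d, δ⟩ h
      simp only [mem_filter, mem_simpleForms hc] at h ⊢
      obtain ⟨⟨h1, h2, h3⟩, rfl⟩ := h
      have hki := add_mul_eq_of_boundary he hce hk h1 h2 h3
      have hek : e * k = 2 * d + e * i := by rw [← hki]; linear_combination d * hce
      rw [hek, cubicWeight]
      ring
  rw [this, mul_left_comm, sum_mul_sub, hK]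
  ring

theorem sum_cubicWeight_of_not_isSquare {c e n : ℤ} (hc : 0 < c) (hce : c * e = 2)
    (hn : ¬ IsSquare n) : ∑ t ∈ simpleForms c n, cubicWeight e t = 0 := by
  rw [sum_cubicWeight hc hce]
  refine sum_eq_zero ?_
  rintro ⟨i, d, δ⟩ h
  simp only [mem_filter, mem_simpleForms hc] at h
  obtain ⟨⟨h1, h2, h3⟩, rfl⟩ := h
  exact absurd ⟨i + c * d, by linear_combination -h3 + c * i * d * hce⟩ hn

theorem sum_cubicWeight_eq {c e n : ℤ} (hc : 0 < c) :
    ∑ t ∈ simpleForms c n, cubicWeight e t =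
      2 * ∑ t ∈ simpleForms c n, (t.2.1 * t.2.2 - e ^ 2 * t.1 ^ 2) * t.2.1 := by
  have h1 := sum_simpleForms_swap (n := n) hc
    fun t => (t.2.1 * t.2.2 - e ^ 2 * t.1 ^ 2) * t.2.1
  have h2 := sum_simpleForms_neg (n := n) hc fun t => e * t.1 * (t.2.1 ^ 2 - t.2.2 ^ 2)
  have h3 : ∑ t ∈ simpleForms c n, e * t.1 * (t.2.1 ^ 2 - t.2.2 ^ 2) = 0 := by
    simp only [mul_neg, neg_mul, sum_neg_distrib] at h2
    lia
  calc ∑ t ∈ simpleForms c n, cubicWeight e t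
      = ∑ t ∈ simpleForms c n, ((t.2.1 * t.2.2 - e ^ 2 * t.1 ^ 2) * t.2.1 +
          (t.2.2 * t.2.1 - e ^ 2 * t.1 ^ 2) * t.2.2 - e * t.1 * (t.2.1 ^ 2 - t.2.2 ^ 2)) :=
        sum_congr rfl fun t _ => by rw [cubicWeight]; ring
    _ = _ := by
        rw [sum_sub_distrib, sum_add_distrib, h3, h1]
        ring

/-- The sum of the positive divisors of `z` not divisible by `4` (zero if `z ≤ 0`). -/
def sumDivisorsNotFour (z : ℤ) : ℤ := ∑ d ∈ z.toNat.divisors with ¬ 4 ∣ d, (d : ℤ)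

theorem sumDivisorsNotFour_of_nonpos {z : ℤ} (hz : z ≤ 0) : sumDivisorsNotFour z = 0 := by
  simp [sumDivisorsNotFour, Int.toNat_of_nonpos hz]

theorem sum_sumDivisorsNotFour_eq_filter (n : ℤ) :
    ∑ i ∈ Icc (-n) n, (n - 5 * i ^ 2) * sumDivisorsNotFour (n - i ^ 2) =
      ∑ t ∈ simpleForms 1 n with ¬ 4 ∣ t.2.1, (t.2.1 * t.2.2 - 2 ^ 2 * t.1 ^ 2) * t.2.1 := by
  simp only [sumDivisorsNotFour, mul_sum]
  rw [sum_sigma']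
  refine sum_bij' (fun x _ => (x.1, (x.2 : ℤ), (n - x.1 ^ 2) / x.2))
    (fun t _ => ⟨t.1, t.2.1.toNat⟩) ?_ ?_ ?_ ?_ ?_
  · rintro ⟨i, d⟩ h
    simp only [mem_sigma, mem_filter, Nat.mem_divisors, mem_simpleForms one_pos] at h ⊢
    obtain ⟨-, ⟨h1, h2⟩, h3⟩ := h
    have hpos : 0 < n - i ^ 2 := by lia
    have hdvd : (d : ℤ) ∣ n - i ^ 2 := by
      have := Int.natCast_dvd_natCast.2 h1
      rwa [Int.toNat_of_nonneg hpos.le] at this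
    have hd : (0 : ℤ) < d := by exact_mod_cast Nat.pos_of_dvd_of_pos h1 (by lia)
    refine ⟨⟨hd, Int.ediv_pos_of_pos_of_dvd hpos hd.le hdvd, ?_⟩, by exact_mod_cast h3⟩
    rw [Int.mul_ediv_cancel' hdvd]
    ring
  · rintro ⟨i, d, δ⟩ h
    have hmem := (mem_filter.1 h).1
    simp only [simpleForms, mem_filter, mem_product] at hmem
    simp only [mem_sigma, mem_filter, Nat.mem_divisors, mem_simpleForms one_pos] at h ⊢
    obtain ⟨⟨h1, h2, h3⟩, h4⟩ := h
    have hdδ : 0 < d * δ := mul_pos h1 h2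
    have heq : n - i ^ 2 = d * δ := by linear_combination -h3
    refine ⟨hmem.1.1, ⟨?_, by lia⟩, by lia⟩
    rw [heq, Int.toNat_mul h1.le h2.le]
    exact dvd_mul_right _ _
  · simp
  · rintro ⟨i, d, δ⟩ h
    simp only [mem_filter, mem_simpleForms one_pos] at h
    obtain ⟨⟨h1, h2, h3⟩, h4⟩ := h
    have heq : n - i ^ 2 = d * δ := by linear_combination -h3
    simp only [Int.toNat_of_nonneg h1.le, heq, Int.mul_ediv_cancel_left _ h1.ne']
  · rintro ⟨i, d⟩ h
    simp only [mem_sigma, mem_filter, Nat.mem_divisors] at h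
    obtain ⟨-, ⟨h1, h2⟩, h3⟩ := h
    have hdvd : (d : ℤ) ∣ n - i ^ 2 := by
      have := Int.natCast_dvd_natCast.2 h1
      rwa [Int.toNat_of_nonneg (by lia)] at this
    simp only [Int.mul_ediv_cancel' hdvd]
    ring

theorem sum_simpleForms_four_dvd (n : ℤ) :
    ∑ t ∈ simpleForms 1 n with 4 ∣ t.2.1, (t.2.1 * t.2.2 - 2 ^ 2 * t.1 ^ 2) * t.2.1 =
      16 * ∑ t ∈ simpleForms 2 n, (t.2.1 * t.2.2 - 1 ^ 2 * t.1 ^ 2) * t.2.1 := by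
  rw [mul_sum]
  refine sum_nbij' (fun t => (t.1, t.2.1 / 4, t.2.2)) (fun t => (t.1, 4 * t.2.1, t.2.2))
    ?_ ?_ ?_ ?_ ?_
  · rintro ⟨i, d, δ⟩ h
    simp only [mem_filter, mem_simpleForms one_pos, mem_simpleForms two_pos] at h ⊢
    obtain ⟨⟨h1, h2, h3⟩, d, rfl⟩ := h
    rw [Int.mul_ediv_cancel_left _ four_ne_zero]
    exact ⟨by lia, h2, by linear_combination h3⟩
  · rintro ⟨i, d, δ⟩ h
    simp only [mem_filter, mem_simpleForms one_pos, mem_simpleForms two_pos] at h ⊢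
    exact ⟨⟨by lia, h.2.1, by linear_combination h.2.2⟩, dvd_mul_right _ _⟩
  · rintro ⟨i, d, δ⟩ h
    simp only [mem_filter] at h
    simp only [Int.mul_ediv_cancel' h.2]
  · simp
  · rintro ⟨i, d, δ⟩ h
    obtain ⟨-, d, rfl⟩ := mem_filter.1 h
    simp only [Int.mul_ediv_cancel_left _ (four_ne_zero' ℤ)]
    ring

theorem two_mul_sum_sumDivisorsNotFour (n : ℤ) :
    2 * ∑ i ∈ Icc (-n) n, (n - 5 * i ^ 2) * sumDivisorsNotFour (n - i ^ 2) =
      ∑ t ∈ simpleForms 1 n, cubicWeight 2 t - 16 * ∑ t ∈ simpleForms 2 n, cubicWeight 1 t := by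
  rw [sum_cubicWeight_eq one_pos, sum_cubicWeight_eq two_pos, sum_sumDivisorsNotFour_eq_filter,
    ← sum_filter_add_sum_filter_not (simpleForms 1 n) (fun t => 4 ∣ t.2.1),
    sum_simpleForms_four_dvd]
  ring

/-- The coefficients of the fourth power of the theta series, in Jacobi's divisor-sum form. -/
def jacobiCoeff (z : ℤ) : ℤ := (if z = 0 then 1 else 0) + 8 * sumDivisorsNotFour z

theorem sum_jacobiCoeff {n : ℤ} (hn : 0 < n) :
    ∑ i ∈ Icc (-n) n, (n - 5 * i ^ 2) * jacobiCoeff (n - i ^ 2) = 0 := by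
  have h := two_mul_sum_sumDivisorsNotFour n
  simp only [jacobiCoeff, mul_add, sum_add_distrib, mul_left_comm _ (8 : ℤ), ← mul_sum]
  by_cases hsq : IsSquare n
  · obtain ⟨k, hk0, rfl⟩ : ∃ k : ℤ, 0 < k ∧ n = k ^ 2 := by
      obtain ⟨k, rfl⟩ := hsq
      exact ⟨|k|, abs_pos.2 (by rintro rfl; simp at hn), by rw [sq_abs, sq]⟩
    have hA := sum_cubicWeight_sq (c := 1) (e := 2) one_pos two_pos rfl hk0
    have hB := sum_cubicWeight_sq (c := 2) (e := 1) two_pos one_pos rfl hk0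
    have hfilter : (Icc (-k ^ 2) (k ^ 2)).filter (fun i => k ^ 2 - i ^ 2 = 0) = {k, -k} := by
      ext i
      have := Int.le_self_sq k
      simp only [mem_filter, mem_Icc, mem_insert, mem_singleton, sub_eq_zero]
      constructor
      · rintro ⟨-, hi⟩
        exact sq_eq_sq_iff_eq_or_eq_neg.1 hi.symm
      · rintro (rfl | rfl) <;> exact ⟨by lia, by ring⟩
    have hdiag : ∑ i ∈ Icc (-k ^ 2) (k ^ 2),
        (k ^ 2 - 5 * i ^ 2) * (if k ^ 2 - i ^ 2 = 0 then 1 else 0) = -8 * k ^ 2 := by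
      simp only [mul_ite, mul_one, mul_zero]
      rw [← sum_filter, hfilter, sum_pair (by lia)]
      ring
    rw [hdiag]
    linarith
  · rw [sum_cubicWeight_of_not_isSquare one_pos (by norm_num) hsq,
      sum_cubicWeight_of_not_isSquare two_pos (by norm_num) hsq] at h
    have hdiag : ∑ i ∈ Icc (-n) n, (n - 5 * i ^ 2) * (if n - i ^ 2 = 0 then 1 else 0) = 0 := by
      refine sum_eq_zero fun i _ => ?_
      rw [if_neg, mul_zero]
      intro hi
      exact hsq ⟨i, by linear_combination hi⟩
    rw [hdiag]
    lia

/-- Quadruples in the cube `[-N, N]⁴` whose squares sum to `z`. -/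
noncomputable def fourSquares (N z : ℤ) : Finset (ℤ × ℤ × ℤ × ℤ) :=
  (Icc (-N) N ×ˢ Icc (-N) N ×ˢ Icc (-N) N ×ˢ Icc (-N) N).filter fun v =>
    v.1 ^ 2 + v.2.1 ^ 2 + v.2.2.1 ^ 2 + v.2.2.2 ^ 2 = z

theorem coe_fourSquares {N z : ℤ} (hz : z ≤ N) :
    (fourSquares N z : Set (ℤ × ℤ × ℤ × ℤ)) =
      {v | v.1 ^ 2 + v.2.1 ^ 2 + v.2.2.1 ^ 2 + v.2.2.2 ^ 2 = z} := by
  ext ⟨a, b, c, d⟩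
  simp only [fourSquares, coe_filter, mem_product, mem_Icc, Set.mem_ofPred_eq,
    and_iff_right_iff_imp]
  intro h
  have bound (x : ℤ) : x ≤ x ^ 2 ∧ -x ≤ x ^ 2 :=
    ⟨Int.le_self_sq x, by simpa using Int.le_self_sq (-x)⟩
  have ha := bound a
  have hb := bound b
  have hc := bound c
  have hd := bound d
  have ha' := sq_nonneg a
  have hb' := sq_nonneg b
  have hc' := sq_nonneg c
  have hd' := sq_nonneg d
  lia

theorem fourSquares_eq {N M z : ℤ} (hN : z ≤ N) (hM : z ≤ M) :
    fourSquares N z = fourSquares M z := by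
  rw [← coe_inj, coe_fourSquares hN, coe_fourSquares hM]

/-- Permuting coordinates shows that the five coordinates contribute equally to the sum of
squares over all representations of `n` as a sum of five squares. -/
theorem sum_card_fourSquares (n : ℤ) :
    ∑ i ∈ Icc (-n) n, (n - 5 * i ^ 2) * ((fourSquares n (n - i ^ 2)).card : ℤ) = 0 := by
  set I := Icc (-n) n with hI
  let p (e a b c d : ℤ) (w : ℤ) : ℤ := if a ^ 2 + b ^ 2 + c ^ 2 + d ^ 2 + e ^ 2 = n then w else 0
  have expand (e w : ℤ) : w * ((fourSquares n (n - e ^ 2)).card : ℤ) =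
      ∑ a ∈ I, ∑ b ∈ I, ∑ c ∈ I, ∑ d ∈ I, p e a b c d w := by
    rw [fourSquares, card_filter]
    simp only [sum_product, ← hI, p]
    push_cast
    simp only [mul_sum, mul_ite, mul_one, mul_zero, eq_sub_iff_add_eq]
  simp only [expand]
  have split (e a b c d : ℤ) : p e a b c d (n - 5 * e ^ 2) =
      (p e a b c d (a ^ 2) - p e a b c d (e ^ 2)) + (p e a b c d (b ^ 2) - p e a b c d (e ^ 2)) +
      (p e a b c d (c ^ 2) - p e a b c d (e ^ 2)) +
      (p e a b c d (d ^ 2) - p e a b c d (e ^ 2)) := by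
    simp only [p]
    split_ifs with h
    · rw [← h]; ring
    · ring
  have ha : ∑ e ∈ I, ∑ a ∈ I, ∑ b ∈ I, ∑ c ∈ I, ∑ d ∈ I, p e a b c d (a ^ 2) =
      ∑ e ∈ I, ∑ a ∈ I, ∑ b ∈ I, ∑ c ∈ I, ∑ d ∈ I, p e a b c d (e ^ 2) := by
    rw [sum_comm]
    refine sum_congr rfl fun a _ => sum_congr rfl fun e _ => ?_
    simp only [p, add_comm, add_left_comm, add_assoc]
  have hb : ∑ e ∈ I, ∑ a ∈ I, ∑ b ∈ I, ∑ c ∈ I, ∑ d ∈ I, p e a b c d (b ^ 2) =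
      ∑ e ∈ I, ∑ a ∈ I, ∑ b ∈ I, ∑ c ∈ I, ∑ d ∈ I, p e a b c d (a ^ 2) := by
    refine sum_congr rfl fun e _ => ?_
    rw [sum_comm]
    refine sum_congr rfl fun a _ => sum_congr rfl fun b _ => ?_
    simp only [p, add_comm, add_left_comm, add_assoc]
  have hc : ∑ e ∈ I, ∑ a ∈ I, ∑ b ∈ I, ∑ c ∈ I, ∑ d ∈ I, p e a b c d (c ^ 2) =
      ∑ e ∈ I, ∑ a ∈ I, ∑ b ∈ I, ∑ c ∈ I, ∑ d ∈ I, p e a b c d (b ^ 2) := by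
    refine sum_congr rfl fun e _ => sum_congr rfl fun a _ => ?_
    rw [sum_comm]
    refine sum_congr rfl fun b _ => sum_congr rfl fun c _ => ?_
    simp only [p, add_comm, add_left_comm, add_assoc]
  have hd : ∑ e ∈ I, ∑ a ∈ I, ∑ b ∈ I, ∑ c ∈ I, ∑ d ∈ I, p e a b c d (d ^ 2) =
      ∑ e ∈ I, ∑ a ∈ I, ∑ b ∈ I, ∑ c ∈ I, ∑ d ∈ I, p e a b c d (c ^ 2) := by
    refine sum_congr rfl fun e _ => sum_congr rfl fun a _ => sum_congr rfl fun b _ => ?_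
    rw [sum_comm]
    refine sum_congr rfl fun c _ => sum_congr rfl fun d _ => ?_
    simp only [p, add_comm, add_assoc]
  simp only [split, sum_add_distrib, sum_sub_distrib]
  rw [hd, hc, hb, ha]
  ring

theorem card_fourSquares_eq_jacobiCoeff (m : ℕ) :
    ((fourSquares m m).card : ℤ) = jacobiCoeff m := by
  induction m using Nat.strong_induction_on with
  | _ m ih =>
    rcases Nat.eq_zero_or_pos m with rfl | hm
    · simp [jacobiCoeff, sumDivisorsNotFour, fourSquares, filter_singleton]
    · have h1 := sum_card_fourSquares (m : ℤ)
      have h2 := sum_jacobiCoeff (n := (m : ℤ)) (by exact_mod_cast hm)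
      rw [← h2, ← sub_eq_zero, ← sum_sub_distrib, sum_eq_single 0] at h1
      · have hm0 : (m : ℤ) ≠ 0 := by lia
        simp only [ne_eq, OfNat.ofNat_ne_zero, not_false_eq_true, zero_pow, mul_zero, sub_zero,
          ← mul_sub, mul_eq_zero, hm0, false_or] at h1
        lia
      · intro i _ hi
        have hi2 : 0 < i ^ 2 := by positivity
        rw [← mul_sub, mul_eq_zero, sub_eq_zero (a := ((fourSquares _ _).card : ℤ))]
        right
        rcases lt_or_ge ((m : ℤ) - i ^ 2) 0 with hneg | hnonneg
        · have hempty : fourSquares m (m - i ^ 2) = ∅ := by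
            refine filter_eq_empty_iff.2 fun v _ hv => ?_
            have : 0 ≤ v.1 ^ 2 + v.2.1 ^ 2 + v.2.2.1 ^ 2 + v.2.2.2 ^ 2 := by positivity
            lia
          rw [hempty, jacobiCoeff, sumDivisorsNotFour_of_nonpos hneg.le, if_neg hneg.ne]
          simp
        · obtain ⟨l, hl⟩ := Int.eq_ofNat_of_zero_le hnonneg
          rw [hl, fourSquares_eq (M := l) (by lia) le_rfl]
          exact ih l (by lia)
      · simp

/-- **The Lagrange–Jacobi four-square theorem** (Jacobi's counting form): for `n ≥ 1`, the set
of quadruples `(a,b,c,d) ∈ ℤ⁴` with `a² + b² + c² + d² = n` is finite, and its cardinality is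
`8` times the sum of the positive divisors of `n` that are not divisible by `4`. -/
theorem lagrange_jacobi_four_squares (n : ℕ) (hn : 1 ≤ n) :
    {v : ℤ × ℤ × ℤ × ℤ | v.1 ^ 2 + v.2.1 ^ 2 + v.2.2.1 ^ 2 + v.2.2.2 ^ 2 = (n : ℤ)}.Finite ∧
    {v : ℤ × ℤ × ℤ × ℤ | v.1 ^ 2 + v.2.1 ^ 2 + v.2.2.1 ^ 2 + v.2.2.2 ^ 2 = (n : ℤ)}.ncard =
      8 * ∑ d ∈ n.divisors.filter (fun d => ¬ (4 ∣ d)), d := by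
  rw [← coe_fourSquares le_rfl]
  refine ⟨Finset.finite_toSet _, ?_⟩
  have hn0 : (n : ℤ) ≠ 0 := by lia
  have h := card_fourSquares_eq_jacobiCoeff n
  rw [jacobiCoeff, if_neg hn0, zero_add, sumDivisorsNotFour, Int.toNat_natCast] at h
  rw [Set.ncard_coe_finset, ← Nat.cast_inj (R := ℤ), h]
  push_cast
  rfl
end
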